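/- arXiv:1710.06045 — 2 statements merged into one kernel-verified Lean document; each statement's English description precedes it below -/
import Mathlib

section
/- Let p ∈ ℂ[z] be a polynomial of degree at least 2 without multiple roots. Then the Lie algebra ⟨LND(D_p)⟩ is simple: it is nonzero and its only Lie ideals are 0 and ⟨LND(D_p)⟩ itself. -/
open Polynomial

noncomputable section

/-- The polynomial ring `ℂ[x,y,z]` (variables indexed by `Fin 3`). -/
abbrev P3 : Type := MvPolynomial (Fin 3) ℂ

/-- The variable `x`. -/
def xP : P3 := MvPolynomial.X 0
/-- The variable `y`. -/
def yP : P3 := MvPolynomial.X 1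
/-- The variable `z`. -/
def zP : P3 := MvPolynomial.X 2

/-- The ideal `(xy - p(z)) ⊆ ℂ[x,y,z]`. -/
def relIdeal (p : ℂ[X]) : Ideal P3 := Ideal.span {xP * yP - Polynomial.aeval zP p}

/-- The coordinate ring `O(D_p) = ℂ[x,y,z]/(xy - p(z))` of the Danielewski surface `D_p`. -/
abbrev ODan (p : ℂ[X]) : Type := P3 ⧸ relIdeal p

/-- A derivation is locally nilpotent if some power of it kills each element. -/
def IsLND {p : ℂ[X]} (δ : Derivation ℂ (ODan p) (ODan p)) : Prop :=
  ∀ f : ODan p, ∃ n : ℕ, 1 ≤ n ∧ (δ.toLinearMap ^ n) f = 0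

/-- The Lie subalgebra `⟨LND(D_p)⟩` of `Der_ℂ(O(D_p))` generated by all locally
nilpotent derivations. -/
def lndSpan (p : ℂ[X]) : LieSubalgebra ℂ (Derivation ℂ (ODan p) (ODan p)) :=
  LieSubalgebra.lieSpan ℂ _ {δ | IsLND δ}


lemma nat_mul_mem_iff (V : Submodule ℂ ℂ[X]) (n : ℕ) (hn : n ≠ 0) (g : ℂ[X])
    (h : (n : ℂ[X]) * g ∈ V) : g ∈ V := by
  have h2 := V.smul_mem ((n : ℂ)⁻¹) h
  have hn' : (n : ℂ) ≠ 0 := by exact_mod_cast hn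
  have : (n : ℂ)⁻¹ • ((n : ℂ[X]) * g) = g := by
    rw [← map_natCast (C : ℂ →+* ℂ[X]), ← smul_eq_C_mul, smul_smul, inv_mul_cancel₀ hn', one_smul]
  rwa [this] at h2

lemma exists_antideriv (g : ℂ[X]) : ∃ h : ℂ[X], derivative h = g := by
  induction g using Polynomial.induction_on' with
  | add a b ha hb =>
    obtain ⟨h, rfl⟩ := ha
    obtain ⟨k, rfl⟩ := hb
    exact ⟨h + k, by simp⟩
  | monomial n a =>
    refine ⟨monomial (n+1) (a / (n+1)), ?_⟩
    rw [derivative_monomial]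
    congr 1
    have : (n : ℂ) + 1 ≠ 0 := by exact_mod_cast Nat.succ_ne_zero n
    push_cast
    field_simp

/-- A family of subspaces becomes full from `e`, going up. -/
lemma full_of_deriv_mem (I : ℕ → Ideal ℂ[X])
    (up : ∀ i, 1 ≤ i → ∀ H ∈ I i, H ∈ I (i+1) ∧ derivative H ∈ I (i+1)) (i : ℕ) (hi : 1 ≤ i)
    (e : ℂ[X]) (he : e ≠ 0) (hei : e ∈ I i) : ∃ N, 1 ≤ N ∧ ∀ j, N ≤ j → I j = ⊤ := by
  have key : ∀ n : ℕ, ∀ i, 1 ≤ i → ∀ e : ℂ[X], e ≠ 0 → e.natDegree = n → e ∈ I i →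
      ∃ N, 1 ≤ N ∧ I N = ⊤ := by
    intro n
    induction n with
    | zero =>
      intro i hi e he hd hei
      obtain ⟨c, rfl⟩ := natDegree_eq_zero.mp hd
      refine ⟨i, hi, Ideal.eq_top_of_isUnit_mem _ hei ?_⟩
      exact (isUnit_C).mpr (isUnit_iff_ne_zero.mpr (by rintro rfl; simp at he))
    | succ n ih =>
      intro i hi e he hd hei
      have hd' : (derivative e).natDegree = n := by
        rw [natDegree_derivative, hd]; rfl
      refine ih (i+1) (by omega) (derivative e) ?_ hd' (up i hi e hei).2
      intro h0
      have := derivative_eq_zero.mp h0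
      omega
  obtain ⟨N, hN, hT⟩ := key _ i hi e he rfl hei
  refine ⟨N, hN, fun j hj => ?_⟩
  induction j, hj using Nat.le_induction with
  | base => exact hT
  | succ j hj ih =>
    rw [Ideal.eq_top_iff_one] at ih ⊢
    exact (up j (by omega) _ ih).1

/-- conductor ideal of a subspace -/
def condI (V : Submodule ℂ ℂ[X]) : Ideal ℂ[X] where
  carrier := {H | ∀ h, H * h ∈ V}
  zero_mem' := by intro h; simp
  add_mem' := by
    intro a b ha hb h
    rw [add_mul]; exact V.add_mem (ha h) (hb h)
  smul_mem' := by
    intro c a ha h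
    rw [smul_eq_mul, mul_comm c, mul_assoc]; exact ha _

lemma mem_cond {V : Submodule ℂ ℂ[X]} {H : ℂ[X]} : H ∈ condI V ↔ ∀ h, H * h ∈ V := Iff.rfl

lemma eq_top_of_cond {V : Submodule ℂ ℂ[X]} (h : condI V = ⊤) : V = ⊤ := by
  rw [Ideal.eq_top_iff_one] at h
  rw [eq_top_iff]
  intro x _
  simpa using h x

lemma cond_of_eq_top {V : Submodule ℂ ℂ[X]} (h : V = ⊤) : condI V = ⊤ := by
  rw [Ideal.eq_top_iff_one]
  intro x
  simp [h]

lemma cond_coprime {V : Submodule ℂ ℂ[X]} {a b : ℂ[X]} (hab : IsCoprime a b)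
    (ha : a ∈ condI V) (hb : b ∈ condI V) : V = ⊤ := by
  apply eq_top_of_cond
  obtain ⟨u, v, h⟩ := hab
  rw [Ideal.eq_top_iff_one, ← h]
  exact Ideal.add_mem _ (Ideal.mul_mem_left _ _ ha) (Ideal.mul_mem_left _ _ hb)

/-- The polynomial heart of simplicity. -/
lemma simple_poly (p : ℂ[X]) (hp : IsCoprime p (derivative p)) (W : ℕ → Submodule ℂ ℂ[X])
    (s1 : ∀ i, 1 ≤ i → ∀ g, ∀ H ∈ W i,
      g * derivative H - (i : ℂ[X]) * (derivative g * H) ∈ W (i+1))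
    (s2 : ∀ i, 1 ≤ i → ∀ g, ∀ H ∈ W (i+1),
      p * g * derivative H + ((i+1 : ℕ) : ℂ[X]) * (derivative (p*g) * H) ∈ W i)
    (i : ℕ) (hi : 1 ≤ i) (e : ℂ[X]) (he : e ≠ 0) (hei : ∀ h, e * h ∈ W i) :
    ∀ i, 1 ≤ i → W i = ⊤ := by
  obtain ⟨N, hN, hT⟩ := full_of_deriv_mem (fun i => condI (W i)) (by
    intro i hi H hH
    have h1 : H ∈ condI (W (i+1)) := by
      intro h
      obtain ⟨k, rfl⟩ := exists_antideriv h
      have a1 := s1 i hi 1 _ (hH k)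
      have a2 := s1 i hi k _ (hH 1)
      have a3 := (W (i+1)).sub_mem a1 a2
      apply nat_mul_mem_iff _ (i+1) (by omega)
      convert a3 using 1
      simp only [derivative_mul, derivative_one]
      push_cast
      ring
    refine ⟨h1, ?_⟩
    intro h
    have a1 := s1 i hi 1 _ (hH h)
    have a2 := (W (i+1)).sub_mem a1 (h1 (derivative h))
    convert a2 using 1
    simp only [derivative_mul, derivative_one]
    ring) i hi e he hei
  have down : ∀ i, 1 ≤ i → condI (W (i+1)) = ⊤ → condI (W i) = ⊤ := by
    intro i hi hc
    have hc' := eq_top_of_cond hc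
    have h1 : p ∈ condI (W i) := by
      intro h
      obtain ⟨k, rfl⟩ := exists_antideriv h
      have a1 := s2 i hi k 1 (by simp [hc'])
      have a2 := s2 i hi 1 k (by simp [hc'])
      have a3 := (W i).sub_mem a1 a2
      apply nat_mul_mem_iff _ i (by omega)
      convert a3 using 1
      simp only [derivative_mul, derivative_one]
      push_cast
      ring
    have h2 : derivative p ∈ condI (W i) := by
      intro h
      have a1 := s2 i hi 1 h (by simp [hc'])
      have a2 := (W i).sub_mem a1 (h1 (derivative h))
      apply nat_mul_mem_iff _ (i+1) (by omega)
      convert a2 using 1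
      simp only [derivative_mul, derivative_one]
      ring
    exact cond_of_eq_top (cond_coprime hp h1 h2)
  have all : ∀ n i, 1 ≤ i → N ≤ i + n → condI (W i) = ⊤ := by
    intro n
    induction n with
    | zero => intro i hi h; exact hT i (by omega)
    | succ n ih => intro i hi h; exact down i hi (ih (i+1) (by omega) (by omega))
  intro i hi
  exact eq_top_of_cond (all N i hi (by omega))


lemma exists_deg_mem (B : Subalgebra ℂ ℂ[X]) (m : ℕ) (hm : 1 ≤ m) (b1 b2 : ℂ[X]) (h1 : b1 ∈ B)
    (h2 : b2 ∈ B) (d1 : b1.natDegree = m) (d2 : b2.natDegree = m + 1) (D : ℕ) (hD : m * m ≤ D) :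
    ∃ b ∈ B, b ≠ 0 ∧ b.natDegree = D := by
  have n1 : b1 ≠ 0 := by rintro rfl; simp at d1; omega
  have n2 : b2 ≠ 0 := by rintro rfl; simp at d2
  have hr : D % m < m := Nat.mod_lt _ (by omega)
  have hq : m ≤ D / m := (Nat.le_div_iff_mul_le (by omega)).mpr hD
  refine ⟨b1 ^ (D / m - D % m) * b2 ^ (D % m), B.mul_mem (B.pow_mem h1 _) (B.pow_mem h2 _),
    mul_ne_zero (pow_ne_zero _ n1) (pow_ne_zero _ n2), ?_⟩
  rw [natDegree_mul (pow_ne_zero _ n1) (pow_ne_zero _ n2), natDegree_pow, natDegree_pow, d1, d2]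
  have := Nat.div_add_mod D m
  obtain ⟨t, ht⟩ : ∃ t, D / m = D % m + t := ⟨D/m - D%m, by omega⟩
  rw [ht] at this ⊢
  rw [Nat.add_sub_cancel_left]
  linarith

lemma exists_sub_mem_degreeLT (B : Subalgebra ℂ ℂ[X]) (N : ℕ)
    (hB : ∀ D, N ≤ D → ∃ b ∈ B, b ≠ 0 ∧ b.natDegree = D) (n : ℕ) :
    ∀ f : ℂ[X], f.natDegree < n → ∃ b ∈ B, f - b ∈ degreeLT ℂ N := by
  induction n with
  | zero => intro f hf; omega
  | succ n ih =>
    intro f hf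
    by_cases hn : f.degree < N
    · exact ⟨0, B.zero_mem, by simpa [mem_degreeLT] using hn⟩
    · have f0 : f ≠ 0 := by rintro rfl; simp at hn
      rw [degree_eq_natDegree f0] at hn
      have hn' : N ≤ f.natDegree := by exact_mod_cast not_lt.mp hn
      obtain ⟨b, hb, b0, hbd⟩ := hB _ hn'
      by_cases hz : f.natDegree = 0
      · obtain ⟨c, rfl⟩ := natDegree_eq_zero.mp hz
        exact ⟨C c, B.algebraMap_mem c, by simp⟩
      set g := f - C (f.leadingCoeff / b.leadingCoeff) * b with hg
      have hlt : g.degree < f.degree := by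
        apply degree_sub_lt_left
        · rw [degree_C_mul (div_ne_zero (leadingCoeff_ne_zero.mpr f0) (leadingCoeff_ne_zero.mpr b0)),
            degree_eq_natDegree f0, degree_eq_natDegree b0, hbd]
        · exact f0
        · rw [leadingCoeff_mul, leadingCoeff_C, div_mul_cancel₀ _ (leadingCoeff_ne_zero.mpr b0)]
      have hgn : g.natDegree < n := by
        by_cases g0 : g = 0
        · rw [g0]; simp; omega
        · have := (natDegree_lt_natDegree_iff g0).mpr hlt
          omega
      obtain ⟨b', hb', hd⟩ := ih g hgn
      refine ⟨b' + C (f.leadingCoeff / b.leadingCoeff) * b, B.add_mem hb'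
        (B.mul_mem (B.algebraMap_mem _) hb), ?_⟩
      convert hd using 1
      rw [hg]; ring

lemma conductor_ne_zero (B : Subalgebra ℂ ℂ[X]) (m : ℕ) (hm : 1 ≤ m) (b1 b2 : ℂ[X]) (h1 : b1 ∈ B)
    (h2 : b2 ∈ B) (d1 : b1.natDegree = m) (d2 : b2.natDegree = m + 1) :
    ∃ e : ℂ[X], e ≠ 0 ∧ ∀ h, e * h ∈ B := by
  set S : Submodule ℂ ℂ[X] := Subalgebra.toSubmodule B with hS
  have hfin : Module.Finite ℂ (ℂ[X] ⧸ S) := by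
    apply Module.Finite.of_surjective (S.mkQ.comp (degreeLT ℂ (m*m)).subtype)
    intro q
    obtain ⟨f, rfl⟩ := S.mkQ_surjective q
    obtain ⟨b, hb, hfb⟩ := exists_sub_mem_degreeLT B (m*m)
      (fun D hD => exists_deg_mem B m hm b1 b2 h1 h2 d1 d2 D hD) _ f (Nat.lt_succ_self _)
    refine ⟨⟨_, hfb⟩, ?_⟩
    have : S.mkQ b = 0 := by simpa [hS] using hb
    simp only [LinearMap.comp_apply, Submodule.subtype_apply, map_sub, this, sub_zero]
  have hle : S ≤ S.comap (LinearMap.mulLeft ℂ b1) := by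
    intro x hx
    exact B.mul_mem h1 hx
  set l : (ℂ[X] ⧸ S) →ₗ[ℂ] (ℂ[X] ⧸ S) := S.mapQ S (LinearMap.mulLeft ℂ b1) hle with hl
  have hpow : ∀ (n : ℕ) (f : ℂ[X]), (l ^ n) (S.mkQ f) = S.mkQ (b1 ^ n * f) := by
    intro n
    induction n with
    | zero => intro f; simp
    | succ n ih =>
      intro f
      rw [pow_succ, Module.End.mul_apply]
      have : l (S.mkQ f) = S.mkQ (b1 * f) := by simp [hl]
      rw [this, ih, pow_succ, mul_assoc]
  have haev : ∀ (q f : ℂ[X]), (aeval l q) (S.mkQ f) = S.mkQ (aeval b1 q * f) := by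
    intro q f
    induction q using Polynomial.induction_on' with
    | add a b ha hb => simp only [map_add, LinearMap.add_apply, ha, hb, add_mul]
    | monomial n a =>
      rw [aeval_monomial, aeval_monomial, Module.End.mul_apply, hpow, mul_assoc,
        ← Algebra.smul_def, map_smul, Module.algebraMap_end_apply]
  refine ⟨aeval b1 l.charpoly, ?_, ?_⟩
  · intro h0
    have : (l.charpoly.comp b1) = 0 := by rwa [aeval_def, algebraMap_eq] at h0
    rw [comp_eq_zero_iff] at this
    rcases this with h | ⟨_, h⟩
    · exact l.charpoly_monic.ne_zero h
    · rw [h, natDegree_C] at d1; omega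
  · intro h
    have := haev l.charpoly h
    rw [LinearMap.aeval_self_charpoly, LinearMap.zero_apply] at this
    have h3 := (Submodule.Quotient.mk_eq_zero S).mp this.symm
    exact h3


structure GenData (p : ℂ[X]) (V W : ℕ → Submodule ℂ ℂ[X]) (V0 : Submodule ℂ ℂ[X]) : Prop where
  oneV : ∀ i, 1 ≤ i → (1 : ℂ[X]) ∈ V i
  oneW : ∀ i, 1 ≤ i → (1 : ℂ[X]) ∈ W i
  upV : ∀ i, 1 ≤ i → ∀ h ∈ V i, derivative h ∈ V (i+1)
  upW : ∀ i, 1 ≤ i → ∀ h ∈ W i, derivative h ∈ W (i+1)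
  r2 : ∀ i, 1 ≤ i → ∀ g ∈ V i, ∀ h ∈ W i, derivative (p^i * (g * h)) ∈ V0
  r3V : ∀ k ∈ V0, ∀ i, 1 ≤ i → ∀ g ∈ V i, derivative k * g ∈ V i
  r3W : ∀ k ∈ V0, ∀ i, 1 ≤ i → ∀ g ∈ W i, derivative k * g ∈ W i
  r4V : ∀ j k, 1 ≤ j → 1 ≤ k → ∀ g ∈ W j, ∀ H ∈ V (k+j),
    (j : ℂ[X]) * (p^j * g * derivative H) + ((k+j : ℕ) : ℂ[X]) * (derivative (p^j * g) * H) ∈ V k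
  r4W : ∀ j k, 1 ≤ j → 1 ≤ k → ∀ g ∈ V j, ∀ H ∈ W (k+j),
    (j : ℂ[X]) * (p^j * g * derivative H) + ((k+j : ℕ) : ℂ[X]) * (derivative (p^j * g) * H) ∈ W k

namespace GenData
variable {p : ℂ[X]} {V W : ℕ → Submodule ℂ ℂ[X]} {V0 : Submodule ℂ ℂ[X]}

lemma swap (D : GenData p V W V0) : GenData p W V V0 :=
  ⟨D.oneW, D.oneV, D.upW, D.upV, fun i hi g hg h hh => by
    rw [mul_comm g h]; exact D.r2 i hi h hh g hg, D.r3W, D.r3V, D.r4W, D.r4V⟩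

lemma adjoin_mul (D : GenData p V W V0) (b : ℂ[X])
    (hb : b ∈ Algebra.adjoin ℂ (derivative '' (V0 : Set ℂ[X]))) (i : ℕ) (hi : 1 ≤ i) (g : ℂ[X])
    (hg : g ∈ V i) : b * g ∈ V i := by
  induction hb using Algebra.adjoin_induction generalizing g with
  | mem x hx =>
    obtain ⟨k, hk, rfl⟩ := hx
    exact D.r3V k hk i hi g hg
  | algebraMap r =>
    rw [← Algebra.smul_def]; exact (V i).smul_mem _ hg
  | add x y _ _ hx hy => rw [add_mul]; exact (V i).add_mem (hx g hg) (hy g hg)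
  | mul x y _ _ hx hy => rw [mul_assoc]; exact hx _ (hy g hg)

lemma conductor (D : GenData p V W V0) (hd : 2 ≤ p.natDegree) :
    ∃ e : ℂ[X], e ≠ 0 ∧ ∀ h, e * h ∈ Algebra.adjoin ℂ (derivative '' (V0 : Set ℂ[X])) := by
  have p0 : p ≠ 0 := by rintro rfl; simp at hd
  have hp' : derivative p ∈ V 1 := by
    have := D.r4V 1 1 le_rfl le_rfl 1 (D.oneW 1 le_rfl) 1 (D.oneV 2 (by norm_num))
    apply nat_mul_mem_iff _ 2 (by norm_num)
    simpa using this
  have p'0 : derivative p ≠ 0 := by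
    intro h
    have := derivative_eq_zero.mp h
    omega
  have d1 := D.r2 1 le_rfl _ hp' _ (D.oneW 1 le_rfl)
  have d2 := D.r2 2 (by norm_num) _ (D.oneV 2 (by norm_num)) _ (D.oneW 2 (by norm_num))
  apply conductor_ne_zero _ (2 * p.natDegree - 3) (by omega) (derivative (derivative (p * derivative p)))
    (derivative (derivative (p^2)))
  · apply Algebra.subset_adjoin
    exact ⟨_, by simpa using d1, rfl⟩
  · apply Algebra.subset_adjoin
    exact ⟨_, by simpa using d2, rfl⟩
  · rw [natDegree_derivative, natDegree_derivative, natDegree_mul p0 p'0, natDegree_derivative]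
    omega
  · rw [natDegree_derivative, natDegree_derivative, natDegree_pow]
    omega

lemma large (D : GenData p V W V0) (hd : 2 ≤ p.natDegree) :
    ∃ N, 1 ≤ N ∧ ∀ j, N ≤ j → V j = ⊤ := by
  obtain ⟨e, e0, he⟩ := D.conductor hd
  obtain ⟨N, hN, h⟩ := full_of_deriv_mem (fun i => ⨅ j, ⨅ (_ : i ≤ j), condI (V j)) (by
    intro i hi H hH
    simp only [Submodule.mem_iInf] at hH ⊢
    refine ⟨fun j hj => hH j (by omega), fun j hj => ?_⟩
    obtain ⟨j, rfl⟩ : ∃ k, j = k + 1 := ⟨j - 1, by omega⟩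
    intro h
    have a1 := D.upV j (by omega) _ (hH j (by omega) h)
    have a2 := (V (j+1)).sub_mem a1 (hH (j+1) (by omega) (derivative h))
    convert a2 using 1
    rw [derivative_mul]; ring) 1 le_rfl e e0 (by
      simp only [Submodule.mem_iInf]
      intro j hj h
      simpa using D.adjoin_mul _ (he h) j hj 1 (D.oneV j hj))
  refine ⟨N, hN, fun j hj => eq_top_of_cond ?_⟩
  have := h j hj
  rw [Ideal.eq_top_iff_one] at this ⊢
  simp only [Submodule.mem_iInf] at this
  exact this j le_rfl

lemma full (D : GenData p V W V0) (hd : 2 ≤ p.natDegree) (hp : IsCoprime p (derivative p)) :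
    ∀ i, 1 ≤ i → V i = ⊤ := by
  obtain ⟨N1, hN1, hV⟩ := D.large hd
  obtain ⟨N2, hN2, hW⟩ := D.swap.large hd
  set s := N1 + N2 with hs
  have hps : ∀ h, p^s * h ∈ W 1 := by
    intro h
    obtain ⟨k, rfl⟩ := exists_antideriv h
    have a1 := D.r4W s 1 (by omega) le_rfl k (by simp [hV s (by omega)]) 1
      (D.oneW _ (by omega))
    have a2 := D.r4W s 1 (by omega) le_rfl 1 (D.oneV _ (by omega)) k
      (by simp [hW (1+s) (by omega)])
    have a3 := (W 1).sub_mem a1 a2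
    convert a3 using 1
    simp only [derivative_mul, derivative_one]
    push_cast
    ring
  have hspan : Ideal.span (derivative '' (W 1 : Set ℂ[X])) = ⊤ := by
    have m1 : derivative (p^s * 1) ∈ Ideal.span (derivative '' (W 1 : Set ℂ[X])) :=
      Ideal.subset_span ⟨_, hps 1, rfl⟩
    have m2 : derivative (p^s * X) ∈ Ideal.span (derivative '' (W 1 : Set ℂ[X])) :=
      Ideal.subset_span ⟨_, hps X, rfl⟩
    have m3 : p^s ∈ Ideal.span (derivative '' (W 1 : Set ℂ[X])) := by
      have := Ideal.sub_mem _ m2 (Ideal.mul_mem_left _ X m1)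
      convert this using 1
      simp only [derivative_mul, derivative_one, derivative_X]
      ring
    have m4 : derivative (derivative (derivative (p^3))) ∈
        Ideal.span (derivative '' (W 1 : Set ℂ[X])) := by
      apply Ideal.subset_span
      refine ⟨derivative (derivative (p^3)), ?_, rfl⟩
      have d3 := D.r2 3 (by norm_num) _ (D.oneV 3 (by norm_num)) _ (D.oneW 3 (by norm_num))
      have := D.r3W _ d3 1 le_rfl 1 (D.oneW 1 le_rfl)
      simpa using this
    have hc : IsCoprime (p^s) (derivative (derivative (derivative (p^3)))) := by
      apply IsCoprime.pow_left
      have : derivative (derivative (derivative (p^3))) = C 6 * (derivative p)^3 +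
          p * (C 18 * derivative p * derivative (derivative p) +
            C 3 * p * derivative (derivative (derivative p))) := by
        have h6 : (C 6 : ℂ[X]) = 6 := rfl
        have h18 : (C 18 : ℂ[X]) = 18 := rfl
        have h3 : (C 3 : ℂ[X]) = 3 := rfl
        simp only [pow_succ, pow_zero, one_mul, derivative_mul, derivative_add]
        rw [h6, h18, h3]
        ring
      rw [this]
      apply IsCoprime.add_mul_left_right
      apply IsCoprime.mul_right
      · exact ⟨0, C (1/6), by rw [zero_mul, zero_add, ← C_mul]; norm_num⟩
      · exact hp.pow_right
    obtain ⟨u, v, huv⟩ := hc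
    rw [Ideal.eq_top_iff_one, ← huv]
    exact Ideal.add_mem _ (Ideal.mul_mem_left _ _ m3) (Ideal.mul_mem_left _ _ m4)
  have down : ∀ k, 1 ≤ k → V (k+1) = ⊤ → V k = ⊤ := by
    intro k hk hT
    have key : ∀ q ∈ Ideal.span (derivative '' (W 1 : Set ℂ[X])), p * q ∈ condI (V k) := by
      intro q hq
      induction hq using Submodule.span_induction with
      | mem x hx =>
        obtain ⟨h, hh, rfl⟩ := hx
        intro H
        have a1 := D.r4V 1 k le_rfl hk h hh H (by simp [hT])
        have a2 := D.r4V 1 k le_rfl hk 1 (D.oneW 1 le_rfl) (h * H) (by simp [hT])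
        have a3 := (V k).sub_mem a1 a2
        apply nat_mul_mem_iff _ k (by omega)
        convert a3 using 1
        simp only [derivative_mul, derivative_one]
        push_cast
        ring_nf
      | zero => simp
      | add x y _ _ hx hy => rw [mul_add]; exact Ideal.add_mem _ hx hy
      | smul a x _ hx =>
        have : p * (a • x) = a * (p * x) := by rw [smul_eq_mul]; ring
        rw [this]; exact Ideal.mul_mem_left _ _ hx
    have h1 : p ∈ condI (V k) := by simpa using key 1 (by simp [hspan])
    refine cond_coprime hp h1 ?_
    intro h
    have a1 := D.r4V 1 k le_rfl hk 1 (D.oneW 1 le_rfl) h (by simp [hT])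
    have a2 := (V k).sub_mem a1 (h1 (derivative h))
    apply nat_mul_mem_iff _ (k+1) (by omega)
    convert a2 using 1
    simp only [pow_one, mul_one]
    push_cast
    ring
  have all : ∀ n i, 1 ≤ i → N1 ≤ i + n → V i = ⊤ := by
    intro n
    induction n with
    | zero => intro i hi h; exact hV i (by omega)
    | succ n ih => intro i hi h; exact down i hi (ih (i+1) (by omega) (by omega))
  intro i hi
  exact all N1 i hi (by omega)

end GenData


/-- Laurent polynomials over `ℂ[z]`. -/
abbrev LR : Type := AddMonoidAlgebra ℂ[X] ℤ

def cf (i : ℤ) : LR →ₗ[ℂ] ℂ[X] where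
  toFun f := f.coeff i
  map_add' f g := by simp
  map_smul' c f := by simp

def mon (i : ℤ) : ℂ[X] →ₗ[ℂ] LR where
  toFun a := AddMonoidAlgebra.single i a
  map_add' f g := by simp [-LaurentPolynomial.single_eq_C_mul_T]
  map_smul' c f := by simp [-LaurentPolynomial.single_eq_C_mul_T]

lemma cf_mon (i j : ℤ) (a : ℂ[X]) : cf j (mon i a) = if i = j then a else 0 := by
  simp only [cf, mon, LinearMap.coe_mk, AddHom.coe_mk, AddMonoidAlgebra.coeff_single]
  exact Finsupp.single_apply

@[simp] lemma cf_mon_same (i : ℤ) (a : ℂ[X]) : cf i (mon i a) = a := by simp [cf_mon]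

lemma cf_mon_ne {i j : ℤ} (h : i ≠ j) (a : ℂ[X]) : cf j (mon i a) = 0 := by simp [cf_mon, h]

lemma LR_ext {f g : LR} (h : ∀ i, cf i f = cf i g) : f = g := by
  apply LaurentPolynomial.ext
  exact h

lemma mon_mul (i j : ℤ) (a b : ℂ[X]) : mon i a * mon j b = mon (i+j) (a*b) := by
  simp only [mon, LinearMap.coe_mk, AddHom.coe_mk, AddMonoidAlgebra.single_mul_single]

lemma one_eq_mon : (1 : LR) = mon 0 1 := rfl

lemma mon_pow (i : ℤ) (a : ℂ[X]) (n : ℕ) : (mon i a)^n = mon (n*i) (a^n) := by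
  induction n with
  | zero => simp [one_eq_mon]
  | succ n ih => rw [pow_succ, ih, mon_mul, pow_succ]; congr 2; push_cast; ring

lemma LR_induction {P : LR → Prop} (f : LR) (add : ∀ f g, P f → P g → P (f+g))
    (hm : ∀ i a, P (mon i a)) : P f := by
  induction f using LaurentPolynomial.induction_on' with
  | add f g hf hg => exact add f g hf hg
  | C_mul_T n a => rw [← LaurentPolynomial.single_eq_C_mul_T]; exact hm n a

def liftL {M : Type*} [AddCommGroup M] [Module ℂ M] (L : ℤ → ℂ[X] →ₗ[ℂ] M) : LR →ₗ[ℂ] M where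
  toFun f := f.coeff.sum (fun i a => L i a)
  map_add' f g := by
    rw [AddMonoidAlgebra.coeff_add]
    exact Finsupp.sum_add_index' (fun i => map_zero _) (fun i => map_add _)
  map_smul' c f := by
    rw [AddMonoidAlgebra.coeff_smul, Finsupp.sum_smul_index' (fun i => map_zero _)]
    simp [Finsupp.smul_sum]

@[simp] lemma liftL_mon {M : Type*} [AddCommGroup M] [Module ℂ M] (L : ℤ → ℂ[X] →ₗ[ℂ] M) (i : ℤ)
    (a : ℂ[X]) : liftL L (mon i a) = L i a := by
  simp only [liftL, mon, LinearMap.coe_mk, AddHom.coe_mk, AddMonoidAlgebra.coeff_single]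
  exact Finsupp.sum_single_index (map_zero _)

/-- Euler derivation `T ∂_T`. -/
def Eu : Derivation ℂ LR LR := Derivation.mk' (liftL fun i => (i : ℂ) • mon i) (by
  intro f g
  induction f using LR_induction with
  | add f f' h h' => simp only [add_mul, map_add, h, h', add_smul, smul_add]; abel
  | hm i a =>
    induction g using LR_induction with
    | add f f' h h' => simp only [mul_add, map_add, h, h', add_smul, smul_add]; abel
    | hm j b =>
      simp only [mon_mul, liftL_mon, LinearMap.smul_apply, smul_eq_mul, mul_smul_comm]
      rw [add_comm j i, mul_comm b a, ← add_smul]; congr 1; push_cast; ring)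

/-- The derivation `∂_z`. -/
def Dz : Derivation ℂ LR LR := Derivation.mk' (liftL fun i => mon i ∘ₗ derivative) (by
  intro f g
  induction f using LR_induction with
  | add f f' h h' => simp only [add_mul, map_add, h, h', add_smul, smul_add]; abel
  | hm i a =>
    induction g using LR_induction with
    | add f f' h h' => simp only [mul_add, map_add, h, h', add_smul, smul_add]; abel
    | hm j b =>
      simp only [mon_mul, liftL_mon, LinearMap.comp_apply, smul_eq_mul, derivative_mul, map_add]
      rw [add_comm j i, mul_comm b, add_comm])

@[simp] lemma Eu_mon (i : ℤ) (a : ℂ[X]) : Eu (mon i a) = (i : ℂ) • mon i a := by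
  change liftL _ (mon i a) = _
  simp
@[simp] lemma Dz_mon (i : ℤ) (a : ℂ[X]) : Dz (mon i a) = mon i (derivative a) := by
  change liftL _ (mon i a) = _
  simp

lemma cf_Eu (i : ℤ) (f : LR) : cf i (Eu f) = (i : ℂ) • cf i f := by
  induction f using LR_induction with
  | add f g hf hg => simp [hf, hg]
  | hm j a =>
    rw [Eu_mon, map_smul, cf_mon]
    split_ifs with h
    · rw [h]
    · simp
lemma cf_Dz (i : ℤ) (f : LR) : cf i (Dz f) = derivative (cf i f) := by
  induction f using LR_induction with
  | add f g hf hg => simp [hf, hg]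
  | hm j a =>
    rw [Dz_mon, cf_mon, cf_mon]
    split_ifs with h <;> simp

lemma Eu_Dz (f : LR) : Eu (Dz f) = Dz (Eu f) := by
  apply LR_ext; intro i; simp [cf_Eu, cf_Dz, derivative_smul]

/-- Poisson bracket. -/
def br (f g : LR) : LR := Eu f * Dz g - Dz f * Eu g

lemma br_add (f g h : LR) : br f (g+h) = br f g + br f h := by simp [br]; ring
lemma add_br (f g h : LR) : br (f+g) h = br f h + br g h := by simp [br]; ring
lemma br_smul (c : ℂ) (f g : LR) : br f (c • g) = c • br f g := by
  simp [br, smul_sub]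
lemma smul_br (c : ℂ) (f g : LR) : br (c • f) g = c • br f g := by
  simp [br, smul_sub]
lemma br_mul (f g h : LR) : br f (g*h) = g * br f h + h * br f g := by simp [br]; ring
lemma br_skew (f g : LR) : br f g = - br g f := by simp only [br]; ring
lemma br_jacobi (f g h : LR) : br (br f g) h = br f (br g h) - br g (br f h) := by
  simp only [br, map_sub, Derivation.leibniz, smul_eq_mul, Eu_Dz]; ring
lemma br_self (f : LR) : br f f = 0 := by simp only [br]; ring

lemma br_mon (i j : ℤ) (a b : ℂ[X]) : br (mon i a) (mon j b) =
    mon (i+j) ((i:ℂ) • (a * derivative b) - (j : ℂ) • (derivative a * b)) := by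
  simp [br, mon_mul]

def brD (f : LR) : Derivation ℂ LR LR := Eu f • Dz - Dz f • Eu
lemma brD_apply (f g : LR) : brD f g = br f g := by simp [brD, br]

/-- top degree estimate -/
def topLE (s : ℤ) (f : LR) : Prop := ∀ k, s < k → cf k f = 0

lemma LR_sum (f : LR) : f = ∑ i ∈ f.coeff.support, mon i (cf i f) := by
  apply LR_ext
  intro k
  rw [map_sum]
  simp only [cf_mon]
  rw [Finset.sum_ite_eq' ]
  split_ifs with h
  · rfl
  · exact Finsupp.notMem_support_iff.mp h

lemma cf_mul (f g : LR) (k : ℤ) :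
    cf k (f * g) = ∑ i ∈ f.coeff.support, cf i f * cf (k - i) g := by
  conv_lhs => rw [LR_sum f, Finset.sum_mul, map_sum]
  apply Finset.sum_congr rfl
  intro i _
  generalize cf i f = a
  induction g using LR_induction with
  | add f g hf hg => simp [hf, hg, mul_add]
  | hm j b =>
    rw [mon_mul, cf_mon, cf_mon]
    by_cases h : i + j = k
    · rw [if_pos h, if_pos (by omega)]
    · rw [if_neg h, if_neg (by omega), mul_zero]

lemma cf_mon_mul (i k : ℤ) (a : ℂ[X]) (g : LR) : cf k (mon i a * g) = a * cf (k - i) g := by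
  induction g using LR_induction with
  | add f g hf hg => simp [hf, hg, mul_add]
  | hm j b =>
    rw [mon_mul, cf_mon, cf_mon]
    by_cases h : i + j = k
    · rw [if_pos h, if_pos (by omega)]
    · rw [if_neg h, if_neg (by omega), mul_zero]

lemma topLE.mul {s t : ℤ} {f g : LR} (hf : topLE s f) (hg : topLE t g) :
    topLE (s+t) (f*g) := by
  intro k hk
  rw [cf_mul]
  apply Finset.sum_eq_zero
  intro i _
  by_cases h : s < i
  · rw [hf i h, zero_mul]
  · rw [hg (k-i) (by omega), mul_zero]

lemma topLE.cf_mul {s t : ℤ} {f g : LR} (hf : topLE s f) (hg : topLE t g) :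
    cf (s+t) (f*g) = cf s f * cf t g := by
  rw [_root_.cf_mul]
  rw [Finset.sum_eq_single s]
  · congr 2; ring_nf
  · intro i _ hi
    by_cases h : s < i
    · rw [hf i h, zero_mul]
    · rw [hg (s+t-i) (by omega), mul_zero]
  · intro h
    have : cf s f = 0 := Finsupp.notMem_support_iff.mp h
    rw [this, zero_mul]

lemma topLE.Eu {s : ℤ} {f : LR} (hf : topLE s f) : topLE s (Eu f) := by
  intro k hk; rw [cf_Eu, hf k hk, smul_zero]
lemma topLE.Dz {s : ℤ} {f : LR} (hf : topLE s f) : topLE s (Dz f) := by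
  intro k hk; rw [cf_Dz, hf k hk, derivative_zero]
lemma topLE.br {s t : ℤ} {f g : LR} (hf : topLE s f) (hg : topLE t g) :
    topLE (s+t) (br f g) := by
  intro k hk
  rw [_root_.br, map_sub, (hf.Eu.mul hg.Dz) k hk, (hf.Dz.mul hg.Eu) k hk, sub_zero]
lemma topLE.cf_br {s t : ℤ} {f g : LR} (hf : topLE s f) (hg : topLE t g) :
    cf (s+t) (_root_.br f g) = (s:ℂ) • (cf s f * derivative (cf t g)) -
      (t:ℂ) • (derivative (cf s f) * cf t g) := by
  rw [_root_.br, map_sub, (hf.Eu.cf_mul hg.Dz), (hf.Dz.cf_mul hg.Eu)]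
  simp only [cf_Eu, cf_Dz, smul_mul_assoc, mul_smul_comm]

/-- `T` as a unit. -/
def Tu : LRˣ := ⟨mon 1 1, mon (-1) 1, by simp [mon_mul, one_eq_mon], by simp [mon_mul, one_eq_mon]⟩

lemma Tu_zpow (n : ℤ) : ((Tu ^ n : LRˣ) : LR) = mon n 1 := by
  induction n using Int.induction_on with
  | zero => simp [one_eq_mon]
  | succ i ih => rw [zpow_add_one, Units.val_mul, ih]; simp [Tu, mon_mul]
  | pred i ih =>
    rw [zpow_sub_one, Units.val_mul, ih]
    change mon (-i) 1 * mon (-1) 1 = _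
    simp [mon_mul, sub_eq_add_neg]

/-- substitution `T ↦ T^A`, `z ↦ w`. -/
def Psi (A : ℤ) (w : LR) : LR →ₐ[ℂ] LR where
  __ := LaurentPolynomial.eval₂ (aeval w : ℂ[X] →ₐ[ℂ] LR).toRingHom (Tu ^ A)
  commutes' r := by
    change LaurentPolynomial.eval₂ (aeval w : ℂ[X] →ₐ[ℂ] LR).toRingHom (Tu ^ A) (LaurentPolynomial.C (C r)) = _
    rw [LaurentPolynomial.eval₂_C]
    simp

lemma Psi_mon (A : ℤ) (w : LR) (i : ℤ) (a : ℂ[X]) :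
    Psi A w (mon i a) = aeval w a * mon (A*i) 1 := by
  change LaurentPolynomial.eval₂ (aeval w : ℂ[X] →ₐ[ℂ] LR).toRingHom (Tu ^ A) (AddMonoidAlgebra.single i a) = _
  rw [LaurentPolynomial.single_eq_C_mul_T, LaurentPolynomial.eval₂_C_mul_T, ← zpow_mul, Tu_zpow]
  rfl

lemma mon_C_mul (i : ℤ) (c : ℂ) (a : ℂ[X]) : mon i (C c * a) = c • mon i a := by
  rw [← map_smul, smul_eq_C_mul]

lemma aeval_mon0 (a : ℂ[X]) : aeval (mon 0 X) a = mon 0 a := by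
  induction a using Polynomial.induction_on' with
  | add p q hp hq => simp only [map_add, hp, hq]
  | monomial n c =>
    rw [← C_mul_X_pow_eq_monomial, map_mul, map_pow, aeval_X, aeval_C, mon_pow, mon_C_mul, Algebra.smul_def]; simp

lemma mon_eq (i : ℤ) (a : ℂ[X]) : mon i a = aeval (mon 0 X) a * ((Tu ^ i : LRˣ) : LR) := by
  rw [Tu_zpow, aeval_mon0, mon_mul]; simp

lemma algHom_ext {S : Type*} [CommRing S] [Algebra ℂ S] (F G : LR →ₐ[ℂ] S) (hz : F (mon 0 X) = G (mon 0 X))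
    (hT : F (mon 1 1) = G (mon 1 1)) : F = G := by
  apply AlgHom.ext
  intro f
  induction f using LR_induction with
  | add f g hf hg => simp [hf, hg]
  | hm i a =>
    have h1 : Units.map (F : LR →* S) Tu = Units.map (G : LR →* S) Tu := by
      ext; exact hT
    have h2 : F ((Tu ^ i : LRˣ) : LR) = G ((Tu ^ i : LRˣ) : LR) := by
      have := congrArg (fun u : Sˣ => ((u ^ i : Sˣ) : S)) h1
      simp only [← map_zpow] at this; exact this
    rw [mon_eq, map_mul, map_mul, h2, ← Polynomial.aeval_algHom_apply, ← Polynomial.aeval_algHom_apply, hz]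

lemma Derivation_Psi (A : ℤ) (w : LR) (D : Derivation ℂ LR LR) (f : LR) :
    D (Psi A w f) = Psi A w (Dz f) * D w + (A:ℂ) • (Psi A w (Eu f) * (D (mon 1 1) * mon (-1) 1)) := by
  have hT : ∀ n : ℤ, D (mon n 1) = (n : ℂ) • (mon n 1 * (D (mon 1 1) * mon (-1) 1)) := by
    have hadd : ∀ n : ℤ, D (mon (n+1) 1) = mon n 1 * D (mon 1 1) + mon 1 1 * D (mon n 1) := by
      intro n
      have : mon (n+1) 1 = mon n 1 * mon 1 1 := by rw [mon_mul]; simp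
      rw [this, Derivation.leibniz]; rfl
    have u1 : (mon 1 1 : LR) * mon (-1) 1 = 1 := by rw [mon_mul]; simp [one_eq_mon]
    have hs : ∀ n : ℤ, (mon (n+1) 1 : LR) = mon n 1 * mon 1 1 := fun n => by rw [mon_mul]; simp
    intro n
    induction n using Int.induction_on with
    | zero => rw [← one_eq_mon]; simp
    | succ i ih =>
      rw [hadd, ih, hs]
      push_cast
      simp only [Algebra.smul_def, map_add, map_one]
      linear_combination (-(mon i 1 * D (mon 1 1))) * u1
    | pred i ih =>
      have h := hadd (-i-1)
      rw [sub_add_cancel, ih] at h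
      have h3 := hs (-i-1)
      rw [sub_add_cancel] at h3
      rw [h3] at h
      push_cast at h ⊢
      simp only [Algebra.smul_def, map_sub, map_neg, map_one] at h ⊢
      linear_combination (-mon (-1) 1) * h + (- D (mon (-i-1) 1) -
        algebraMap ℂ LR i * mon (-i-1) 1 * D (mon 1 1) * mon (-1) 1) * u1
  induction f using LR_induction with
  | add f g hf hg => simp only [map_add, hf, hg, add_mul, smul_add]; abel
  | hm i a =>
    rw [Psi_mon, Derivation.leibniz, hT, Derivation.map_aeval, Dz_mon, Eu_mon, map_smul, Psi_mon, Psi_mon]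
    simp only [smul_eq_mul, mul_smul_comm, smul_mul_assoc, smul_smul]
    push_cast
    ring

lemma br_Psi (A : ℤ) (w f g : LR) :
    br (Psi A w f) (Psi A w g) = (A:ℂ) • (Dz w * Psi A w (br f g)) := by
  simp only [br, Derivation_Psi, Dz_mon, Eu_mon, map_sub, map_mul, derivative_one, map_zero, zero_mul,
    mul_zero, smul_zero, add_zero]
  simp only [Int.cast_one, one_smul, mon_mul]
  rw [show ((1:ℤ) + -1) = 0 by norm_num, one_mul, ← one_eq_mon]
  simp only [mul_one, Algebra.smul_def]
  ring


/-- substitution `T ↦ T^A`, `z ↦ z T^B`. -/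
def Theta (A B : ℤ) : LR →ₐ[ℂ] LR := Psi A (mon B X)

lemma aeval_mon_monomial (B : ℤ) (j : ℕ) (c : ℂ) :
    aeval (mon B X) (monomial j c) = mon (B*j) (monomial j c) := by
  rw [← C_mul_X_pow_eq_monomial, map_mul, map_pow, aeval_X, aeval_C, mon_pow, mon_C_mul,
    Algebra.smul_def, mul_comm B]

lemma Theta_monomial (A B i : ℤ) (j : ℕ) (c : ℂ) :
    Theta A B (mon i (monomial j c)) = mon (A*i+B*j) (monomial j c) := by
  rw [Theta, Psi_mon, aeval_mon_monomial, mon_mul, mul_one, add_comm]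

lemma LR_induction_monomial {P : LR → Prop} (f : LR) (add : ∀ f g, P f → P g → P (f+g))
    (hm : ∀ i j c, P (mon i (monomial j c))) : P f := by
  induction f using LR_induction with
  | add f g hf hg => exact add f g hf hg
  | hm i a =>
    induction a using Polynomial.induction_on' with
    | add p q hp hq => rw [map_add]; exact add _ _ hp hq
    | monomial n c => exact hm _ _ _

lemma coeff_Theta (A B : ℤ) (hA : A ≠ 0) (f : LR) (i : ℤ) (j : ℕ) :
    (cf (A*i+B*j) (Theta A B f)).coeff j = (cf i f).coeff j := by
  induction f using LR_induction_monomial with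
  | add f g hf hg => simp only [map_add, coeff_add, hf, hg]
  | hm i' j' c =>
    rw [Theta_monomial, cf_mon, cf_mon]
    by_cases hj : j' = j
    · subst hj
      by_cases hi : i' = i
      · subst hi; simp
      · rw [if_neg hi, if_neg]
        intro h
        exact hi (mul_left_cancel₀ hA (by linarith))
    · split_ifs <;> simp [coeff_monomial, hj]

lemma coeff_Theta_eq_zero (A B : ℤ) (f : LR) (k : ℤ) (j : ℕ) (h : ∀ i, A*i+B*j ≠ k) :
    (cf k (Theta A B f)).coeff j = 0 := by
  induction f using LR_induction_monomial with
  | add f g hf hg => simp only [map_add, coeff_add, hf, hg, add_zero]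
  | hm i' j' c =>
    rw [Theta_monomial, cf_mon]
    by_cases hj : j' = j
    · subst hj
      rw [if_neg (h i')]; simp
    · split_ifs <;> simp [coeff_monomial, hj]

/-- if every term of `f` has weight at most `W`. -/
lemma topLE_Theta (A B : ℤ) (hA : A ≠ 0) (f : LR) (W : ℤ)
    (h : ∀ i j, (cf i f).coeff j ≠ 0 → A*i+B*j ≤ W) : topLE W (Theta A B f) := by
  intro k hk
  ext j
  rw [coeff_zero]
  by_cases hh : ∃ i, A*i+B*j = k
  · obtain ⟨i, rfl⟩ := hh
    rw [coeff_Theta A B hA]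
    by_contra h0
    have := h i j h0
    omega
  · push Not at hh
    exact coeff_Theta_eq_zero A B f k j hh

lemma Theta_br (A B : ℤ) (f g : LR) :
    br (Theta A B f) (Theta A B g) = (A:ℂ) • (mon B 1 * Theta A B (br f g)) := by
  rw [Theta, br_Psi, Dz_mon, derivative_X]

lemma Theta_step (A B : ℤ) (hA : A ≠ 0) (f g : LR) (W s : ℤ) (hf : topLE W (Theta A B f))
    (hg : topLE s (Theta A B g)) : topLE (s + W - B) (Theta A B (br f g)) ∧
    (A:ℂ) • cf (s+W-B) (Theta A B (br f g)) =
      (W:ℂ) • (cf W (Theta A B f) * derivative (cf s (Theta A B g)))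
      - (s:ℂ) • (derivative (cf W (Theta A B f)) * cf s (Theta A B g)) := by
  have hA' : (A:ℂ) ≠ 0 := by exact_mod_cast hA
  have key : ∀ k, (A:ℂ) • cf (k - B) (Theta A B (br f g)) = cf k (br (Theta A B f) (Theta A B g)) := by
    intro k
    rw [Theta_br, map_smul, cf_mon_mul, one_mul]
  constructor
  · intro k hk
    have h1 := key (k+B)
    rw [(hf.br hg) (k+B) (by omega)] at h1
    rw [add_sub_cancel_right] at h1
    exact (smul_eq_zero.mp h1).resolve_left hA'
  · rw [key, add_comm s W, hf.cf_br hg]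

lemma order_step (c : ℂ) (W s : ℤ) (r q : ℕ) (F1 G1 : ℂ[X]) :
    (W:ℂ) • (((X - C c)^(r+1) * F1) * derivative ((X - C c)^q * G1)) -
      (s:ℂ) • (derivative ((X - C c)^(r+1) * F1) * ((X - C c)^q * G1)) =
    (X - C c)^(q + r) * (((W * q - s * (r+1) : ℤ) : ℂ) • (F1 * G1) +
      (X - C c) * ((W:ℂ) • (F1 * derivative G1) - (s:ℂ) • (derivative F1 * G1))) := by
  have h1 : derivative ((X - C c)^(r+1)) = C ((r:ℂ)+1) * (X - C c)^r := by
    rw [derivative_X_sub_C_pow]; simp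
  rw [derivative_mul, derivative_mul, h1]
  rcases q with _ | q
  · simp only [smul_eq_C_mul, map_sub, map_mul, map_add, pow_zero, derivative_one]
    push_cast
    simp only [map_sub, map_mul, map_add, map_one, map_zero, map_natCast, map_intCast, map_neg]
    ring
  · have h2 : derivative ((X - C c)^(q+1)) = C ((q:ℂ)+1) * (X - C c)^q := by
      rw [derivative_X_sub_C_pow]; simp
    rw [h2]
    simp only [smul_eq_C_mul]
    push_cast
    simp only [map_sub, map_mul, map_add, map_one, map_natCast, map_intCast, map_neg]
    ring

lemma order_lemma (A B : ℤ) (hA : A ≠ 0) (f g : LR) (W s : ℤ) (hf : topLE W (Theta A B f))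
    (hg : topLE s (Theta A B g)) (c : ℂ) (r q : ℕ) (F1 G1 : ℂ[X])
    (hF : cf W (Theta A B f) = (X - C c)^(r+1) * F1) (hF1 : F1.eval c ≠ 0)
    (hG : cf s (Theta A B g) = (X - C c)^q * G1) (hG1 : G1.eval c ≠ 0)
    (hn : ∃ n, (br f)^[n] g = 0) :
    ∃ n : ℕ, W * (q + n * r) = (r+1) * (s + n * (W - B)) := by
  by_contra hcon
  push Not at hcon
  have hA' : (A:ℂ) ≠ 0 := by exact_mod_cast hA
  have key : ∀ n : ℕ, topLE (s + n * (W - B)) (Theta A B ((br f)^[n] g)) ∧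
      ∃ G : ℂ[X], cf (s + n * (W - B)) (Theta A B ((br f)^[n] g)) = (X - C c)^(q + n * r) * G ∧
        G.eval c ≠ 0 := by
    intro n
    induction n with
    | zero => simpa using ⟨hg, G1, hG, hG1⟩
    | succ n ih =>
      obtain ⟨h1, G, h2, h3⟩ := ih
      obtain ⟨a1, a2⟩ := Theta_step A B hA f _ W _ hf h1
      rw [Function.iterate_succ_apply']
      have e : s + ((n+1 : ℕ) : ℤ) * (W - B) = s + n * (W - B) + W - B := by push_cast; ring
      rw [e]
      refine ⟨a1, ?_⟩
      rw [hF, h2, order_step] at a2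
      refine ⟨(A:ℂ)⁻¹ • (((W * (q + n * r : ℕ) - (s + n * (W - B)) * (r+1) : ℤ) : ℂ) • (F1 * G) +
        (X - C c) * ((W:ℂ) • (F1 * derivative G) - ((s + n * (W - B) : ℤ):ℂ) • (derivative F1 * G))), ?_, ?_⟩
      · rw [mul_smul_comm]
        rw [eq_inv_smul_iff₀ hA', a2]
        congr 2; ring
      · simp only [eval_smul, eval_add, eval_mul, eval_sub, eval_X, eval_C, sub_self, zero_mul,
          add_zero, smul_eq_mul]
        refine mul_ne_zero (inv_ne_zero hA') (mul_ne_zero ?_ (mul_ne_zero hF1 h3))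
        have := hcon n
        rw [← sub_ne_zero] at this
        have h4 : (W * ↑(q + n * r) - (s + ↑n * (W - B)) * (↑r + 1) : ℤ) ≠ 0 := by
          intro h; apply this; push_cast at h; linarith
        exact_mod_cast h4
  obtain ⟨n, hn⟩ := hn
  obtain ⟨-, G, h2, h3⟩ := key n
  rw [hn, map_zero, map_zero] at h2
  have : G = 0 := by
    rcases mul_eq_zero.mp h2.symm with h | h
    · exact absurd h (pow_ne_zero _ (X_sub_C_ne_zero c))
    · exact h
  rw [this] at h3
  simp at h3

lemma Theta_x (A B : ℤ) : Theta A B (mon 1 1) = mon A 1 := by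
  have := Theta_monomial A B 1 0 1
  simpa using this

lemma topLE_mon (i : ℤ) (a : ℂ[X]) : topLE i (mon i a) := by
  intro k hk; rw [cf_mon_ne (by omega)]

lemma topLE_y (p : ℂ[X]) (A B : ℤ) (hA : A ≠ 0) (hB : 0 < B) :
    topLE (B * p.natDegree - A) (Theta A B (mon (-1) p)) := by
  apply topLE_Theta _ _ hA
  intro i j h
  rw [cf_mon] at h
  split_ifs at h with hi
  · have := le_natDegree_of_ne_zero h
    have : (j:ℤ) ≤ p.natDegree := by exact_mod_cast this
    have := mul_le_mul_of_nonneg_left this hB.le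
    subst hi
    linarith
  · simp at h

lemma cf_y (p : ℂ[X]) (A B : ℤ) (hA : A ≠ 0) (hB : 0 < B) :
    cf (B * p.natDegree - A) (Theta A B (mon (-1) p)) = C p.leadingCoeff * X ^ p.natDegree := by
  ext j
  rw [coeff_C_mul_X_pow]
  split_ifs with h
  · subst h
    have := coeff_Theta A B hA (mon (-1) p) (-1) p.natDegree
    rw [show B * (p.natDegree:ℤ) - A = A * (-1) + B * p.natDegree by ring, this, cf_mon_same]
    rfl
  · by_cases hi : ∃ i, A*i+B*j = B * p.natDegree - A
    · obtain ⟨i, hi⟩ := hi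
      rw [← hi, coeff_Theta A B hA, cf_mon]
      split_ifs with h2
      · exfalso; apply h
        subst h2
        have : B * (j:ℤ) = B * p.natDegree := by linarith
        exact_mod_cast mul_left_cancel₀ hB.ne' this
      · simp
    · push Not at hi
      exact coeff_Theta_eq_zero A B _ _ j hi

lemma vertex (p : ℂ[X]) (p0 : p ≠ 0) (hd : 1 ≤ p.natDegree) (f : LR) (hx : ∃ n, (br f)^[n] (mon 1 1) = 0)
    (hy : ∃ n, (br f)^[n] (mon (-1) p) = 0) (α β : ℤ) (hα : 0 < α) (hβ : 0 < β) (i0 : ℤ) (j0 : ℕ)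
    (h0 : (cf i0 f).coeff j0 ≠ 0) (he : 0 ≤ p.natDegree * i0 + j0)
    (hmax : ∀ i j, (cf i f).coeff j ≠ 0 → (i = i0 ∧ j = j0) ∨
      α * (p.natDegree * i + j) + β * j < α * (p.natDegree * i0 + j0) + β * j0) :
    j0 = 0 ∨ p.natDegree * i0 + j0 = 0 := by
  set d := p.natDegree with hdd
  by_contra hcon
  push Not at hcon
  obtain ⟨hj0, he0⟩ := hcon
  obtain ⟨r, rfl⟩ := Nat.exists_eq_succ_of_ne_zero hj0
  set A : ℤ := α * d with hAdef
  set B : ℤ := α + β with hBdef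
  have hd' : (0:ℤ) < d := by exact_mod_cast hd
  have hA : 0 < A := mul_pos hα hd'
  have hB : 0 < B := by omega
  set W : ℤ := A * i0 + B * (r+1 : ℕ) with hW
  have htop : topLE W (Theta A B f) := by
    apply topLE_Theta _ _ hA.ne'
    intro i j h
    rcases hmax i j h with ⟨rfl, rfl⟩ | h
    · rfl
    · simp only [hW, hAdef, hBdef]; simp only [Nat.succ_eq_add_one] at h; nlinarith
  have hF : cf W (Theta A B f) = (X - C 0)^(r+1) * C ((cf i0 f).coeff (r+1)) := by
    ext j
    rw [C_0, sub_zero, mul_comm, coeff_C_mul_X_pow]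
    split_ifs with h
    · subst h; rw [hW, coeff_Theta A B hA.ne']
    · by_cases hi : ∃ i, A*i+B*j = W
      · obtain ⟨i, hi⟩ := hi
        rw [← hi, coeff_Theta A B hA.ne']
        by_contra h2
        rcases hmax i j h2 with ⟨_, h3⟩ | h3
        · exact h h3
        · have : A*i+B*j < W := by simp only [hW, hAdef, hBdef]; simp only [Nat.succ_eq_add_one] at h3; nlinarith
          omega
      · push Not at hi
        exact coeff_Theta_eq_zero A B _ _ j hi
  have hF1 : (C ((cf i0 f).coeff (r+1))).eval 0 ≠ 0 := by simpa using h0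
  obtain ⟨n, hn⟩ := order_lemma A B hA.ne' f (mon 1 1) W A htop (by rw [Theta_x]; exact topLE_mon _ _)
    0 r 0 _ 1 hF hF1 (by simp [Theta_x]) (by simp) hx
  obtain ⟨m, hm⟩ := order_lemma A B hA.ne' f (mon (-1) p) W (B * d - A) htop
    (topLE_y p A B hA.ne' hB) 0 r d _ (C p.leadingCoeff) hF hF1 (by rw [cf_y p A B hA.ne' hB, C_0, sub_zero, mul_comm])
    (by simpa using p0) hy
  have e1 : A * (-(n * i0)) = A * (r+1) := by
    simp only [hW] at hn; push_cast at hn; linear_combination hn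
  have e2 : A * (m * i0) = A * (d * i0 + (r + 1)) := by
    simp only [hW] at hm; push_cast at hm; linear_combination -hm
  have e1 := mul_left_cancel₀ hA.ne' e1
  have e2 := mul_left_cancel₀ hA.ne' e2
  have hi0 : i0 < 0 := by
    by_contra h
    push Not at h
    have : 0 ≤ (n:ℤ) * i0 := by positivity
    omega
  have h5 : (m:ℤ) * i0 ≤ 0 := mul_nonpos_of_nonneg_of_nonpos (by positivity) hi0.le
  push_cast at he he0
  omega


section
variable (p : ℂ[X])

def oX : ODan p := Ideal.Quotient.mk _ xP
def oY : ODan p := Ideal.Quotient.mk _ yP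
def oZ : ODan p := Ideal.Quotient.mk _ zP

variable {p}

lemma mk_aeval (a : ℂ[X]) : (Ideal.Quotient.mk (relIdeal p)) (aeval zP a) = aeval (oZ p) a := by
  have := Polynomial.aeval_algHom_apply (Ideal.Quotient.mkₐ ℂ (relIdeal p)) zP a
  exact this.symm

lemma oX_mul_oY : oX p * oY p = aeval (oZ p) p := by
  rw [← mk_aeval, oX, oY, ← map_mul]
  rw [Ideal.Quotient.eq]
  exact Ideal.subset_span rfl

lemma ODan_induction {P : ODan p → Prop} (a : ODan p) (hC : ∀ c, P (algebraMap ℂ _ c))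
    (add : ∀ a b, P a → P b → P (a+b)) (mulX : ∀ a, P a → P (oX p * a))
    (mulY : ∀ a, P a → P (oY p * a)) (mulZ : ∀ a, P a → P (oZ p * a)) : P a := by
  obtain ⟨a, rfl⟩ := Ideal.Quotient.mk_surjective a
  induction a using MvPolynomial.induction_on with
  | C c => exact hC c
  | add a b ha hb => rw [map_add]; exact add _ _ ha hb
  | mul_X a i ha =>
    rw [map_mul, mul_comm]
    fin_cases i
    · exact mulX _ ha
    · exact mulY _ ha
    · exact mulZ _ ha

/-- universal property -/
def oLift {S : Type*} [CommRing S] [Algebra ℂ S] (x y z : S) (h : x * y = aeval z p) :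
    ODan p →ₐ[ℂ] S :=
  Ideal.Quotient.liftₐ (relIdeal p) (MvPolynomial.aeval ![x, y, z]) (by
    intro a ha
    change a ∈ RingHom.ker (MvPolynomial.aeval ![x, y, z] : P3 →ₐ[ℂ] S)
    revert a
    change relIdeal p ≤ _
    rw [relIdeal, Ideal.span_le, Set.singleton_subset_iff]
    change _ = _
    rw [map_sub, map_mul, ← Polynomial.aeval_algHom_apply]
    simp [xP, yP, zP, h])

section
variable {S : Type*} [CommRing S] [Algebra ℂ S] (x y z : S) (h : x * y = aeval z p)
@[simp] lemma oLift_X : oLift x y z h (oX p) = x := by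
  change MvPolynomial.aeval ![x, y, z] xP = x
  simp [xP]
@[simp] lemma oLift_Y : oLift x y z h (oY p) = y := by
  change MvPolynomial.aeval ![x, y, z] yP = y
  simp [yP]
@[simp] lemma oLift_Z : oLift x y z h (oZ p) = z := by
  change MvPolynomial.aeval ![x, y, z] zP = z
  simp [zP]
end

variable (p) in
def Phi : ODan p →ₐ[ℂ] LR := oLift (mon 1 1) (mon (-1) p) (mon 0 X) (by
  rw [mon_mul, aeval_mon0]; simp)

@[simp] lemma Phi_X : Phi p (oX p) = mon 1 1 := oLift_X ..
@[simp] lemma Phi_Y : Phi p (oY p) = mon (-1) p := oLift_Y ..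
@[simp] lemma Phi_Z : Phi p (oZ p) = mon 0 X := oLift_Z ..
lemma Phi_aeval (a : ℂ[X]) : Phi p (aeval (oZ p) a) = mon 0 a := by
  rw [← Polynomial.aeval_algHom_apply, Phi_Z, aeval_mon0]

variable (p) in
/-- `x^i a(z)` -/
def xg (i : ℕ) (a : ℂ[X]) : ODan p := oX p ^ i * aeval (oZ p) a
variable (p) in
def yg (i : ℕ) (a : ℂ[X]) : ODan p := oY p ^ i * aeval (oZ p) a

@[simp] lemma Phi_xg (i : ℕ) (a : ℂ[X]) : Phi p (xg p i a) = mon i a := by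
  rw [xg, map_mul, map_pow, Phi_X, mon_pow, Phi_aeval, mon_mul]; simp
@[simp] lemma Phi_yg (i : ℕ) (a : ℂ[X]) : Phi p (yg p i a) = mon (-i) (p^i * a) := by
  rw [yg, map_mul, map_pow, Phi_Y, mon_pow, Phi_aeval, mon_mul]; simp

lemma oSpan (a : ODan p) {P : ODan p → Prop} (add : ∀ a b, P a → P b → P (a+b))
    (hx : ∀ i g, P (xg p i g)) (hy : ∀ i g, P (yg p i g)) : P a := by
  let S : Submodule ℂ (ODan p) := Submodule.span ℂ
    ({a | ∃ i g, a = xg p i g} ∪ {a | ∃ i g, a = yg p i g})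
  have hS : ∀ a, a ∈ S := by
    have mX : ∀ i g, xg p i g ∈ S := fun i g => Submodule.subset_span (Or.inl ⟨i, g, rfl⟩)
    have mY : ∀ i g, yg p i g ∈ S := fun i g => Submodule.subset_span (Or.inr ⟨i, g, rfl⟩)
    have step : ∀ w : ODan p, (∀ i g, w * xg p i g ∈ S) → (∀ i g, w * yg p i g ∈ S) →
        ∀ a ∈ S, w * a ∈ S := by
      intro w h1 h2 a ha
      induction ha using Submodule.span_induction with
      | mem a ha =>
        rcases ha with ⟨i, g, rfl⟩ | ⟨i, g, rfl⟩
        · exact h1 i g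
        · exact h2 i g
      | zero => simp
      | add a b _ _ ha hb => rw [mul_add]; exact S.add_mem ha hb
      | smul c a _ ha => rw [mul_smul_comm]; exact S.smul_mem c ha
    intro a
    induction a using ODan_induction with
    | hC c =>
      have := mX 0 (C c)
      simpa [xg] using this
    | add a b ha hb => exact S.add_mem ha hb
    | mulX a ha =>
      refine step _ ?_ ?_ a ha
      · intro i g
        convert mX (i+1) g using 1
        simp only [xg]; ring
      · intro i g
        rcases i with _ | i
        · convert mX 1 g using 1
          simp only [xg, yg]; ring
        · convert mY i (p*g) using 1
          simp only [yg, map_mul, ← oX_mul_oY]; ring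
    | mulY a ha =>
      refine step _ ?_ ?_ a ha
      · intro i g
        rcases i with _ | i
        · convert mY 1 g using 1
          simp only [xg, yg]; ring
        · convert mX i (p*g) using 1
          simp only [xg, map_mul, ← oX_mul_oY]; ring
      · intro i g
        convert mY (i+1) g using 1
        simp only [yg]; ring
    | mulZ a ha =>
      refine step _ ?_ ?_ a ha
      · intro i g
        convert mX i (X*g) using 1
        simp only [xg, map_mul, aeval_X]; ring
      · intro i g
        convert mY i (X*g) using 1
        simp only [yg, map_mul, aeval_X]; ring
  have hsm : ∀ c : ℂ, ∀ a, (∃ i g, a = xg p i g) ∨ (∃ i g, a = yg p i g) → P (c • a) := by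
    rintro c a (⟨i, g, rfl⟩ | ⟨i, g, rfl⟩)
    · convert hx i (c • g) using 1
      simp only [xg, map_smul]; exact (Algebra.mul_smul_comm c _ _).symm
    · convert hy i (c • g) using 1
      simp only [yg, map_smul]; exact (Algebra.mul_smul_comm c _ _).symm
  have h0 : P 0 := by
    have := hx 0 0
    simpa [xg] using this
  have := hS a
  induction this using Submodule.closure_induction with
  | zero => exact h0
  | add a b _ _ ha hb => exact add _ _ ha hb
  | smul_mem c a ha => exact hsm c a ha

variable (p) in
def ASub : Subalgebra ℂ LR where
  carrier := {f | ∀ i : ℤ, p^(-i).toNat ∣ cf i f}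
  add_mem' := by
    intro f g hf hg i
    rw [map_add]; exact dvd_add (hf i) (hg i)
  mul_mem' := by
    intro f g hf hg i
    rw [cf_mul]
    apply Finset.dvd_sum
    intro j _
    refine dvd_trans ?_ (mul_dvd_mul (hf j) (hg (i-j)))
    rw [← pow_add]
    exact pow_dvd_pow _ (by omega)
  algebraMap_mem' := by
    intro c i
    have : algebraMap ℂ LR c = mon 0 (C c) := rfl
    rw [this, cf_mon]
    split_ifs with h
    · subst h; simp
    · simp

lemma mem_ASub {f : LR} : f ∈ ASub p ↔ ∀ i : ℤ, p^(-i).toNat ∣ cf i f := Iff.rfl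

lemma Phi_mem (a : ODan p) : Phi p a ∈ ASub p := by
  induction a using oSpan with
  | add a b ha hb => rw [map_add]; exact add_mem ha hb
  | hx i g =>
    intro j
    rw [Phi_xg, cf_mon]
    split_ifs with h
    · subst h; simp
    · simp
  | hy i g =>
    intro j
    rw [Phi_yg, cf_mon]
    split_ifs with h
    · subst h; simp
    · simp

lemma Phi_surj {f : LR} (hf : f ∈ ASub p) : ∃ a, Phi p a = f := by
  have : f ∈ (Phi p).range := by
    rw [LR_sum f]
    apply sum_mem
    intro i _
    obtain ⟨g, hg⟩ := hf i
    rw [hg]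
    rcases le_total 0 i with h | h
    · lift i to ℕ using h
      exact ⟨xg p i g, by simp⟩
    · obtain ⟨n, rfl⟩ : ∃ n : ℕ, i = -n := ⟨(-i).toNat, by omega⟩
      exact ⟨yg p n g, by simp⟩
  exact this

variable (p) in
def nu : LR →ₗ[ℂ] ODan p := liftL fun i =>
  (LinearMap.mulLeft ℂ (oX p ^ i.toNat * oY p ^ (-i).toNat)) ∘ₗ (aeval (oZ p) : ℂ[X] →ₐ[ℂ] _).toLinearMap

lemma nu_surj (a : ODan p) : ∃ f, nu p f = a := by
  induction a using oSpan with
  | add a b ha hb =>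
    obtain ⟨f, rfl⟩ := ha
    obtain ⟨g, rfl⟩ := hb
    exact ⟨f+g, map_add _ _ _⟩
  | hx i g => exact ⟨mon i g, by simp [nu, xg]⟩
  | hy i g => exact ⟨mon (-i) g, by simp [nu, yg]⟩

lemma cf_Phi_nu (f : LR) (i : ℤ) : cf i (Phi p (nu p f)) = p^(-i).toNat * cf i f := by
  induction f using LR_induction with
  | add f g hf hg => simp only [map_add, hf, hg, mul_add]
  | hm j a =>
    have : Phi p (nu p (mon j a)) = mon j (p^(-j).toNat * a) := by
      simp only [nu, liftL_mon, LinearMap.comp_apply, LinearMap.mulLeft_apply, map_mul, map_pow, Phi_X, Phi_Y,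
        AlgHom.toLinearMap_apply, Phi_aeval, mon_pow, mon_mul]
      congr 1
      · congr 1; omega
      · simp
    rw [this, cf_mon, cf_mon]
    split_ifs with h
    · rw [h]
    · simp

lemma Phi_inj (p0 : p ≠ 0) : Function.Injective (Phi p) := by
  rw [injective_iff_map_eq_zero]
  intro a ha
  obtain ⟨f, rfl⟩ := nu_surj a
  have : f = 0 := by
    apply LR_ext
    intro i
    have := cf_Phi_nu (p := p) f i
    rw [ha, map_zero] at this
    rcases mul_eq_zero.mp this.symm with h | h
    · exact absurd h (pow_ne_zero _ p0)
    · rw [h, map_zero]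
  rw [this, map_zero]

end


section
variable {p : ℂ[X]}

lemma br_C (f : LR) (c : ℂ) : br f (algebraMap ℂ LR c) = 0 := by
  simp only [br, Derivation.map_algebraMap]; ring

lemma C_br (f : LR) (c : ℂ) : br (algebraMap ℂ LR c) f = 0 := by
  simp only [br, Derivation.map_algebraMap]; ring

lemma Phi_br_aux (w : LR) (hX : br w (Phi p (oX p)) ∈ ASub p) (hY : br w (Phi p (oY p)) ∈ ASub p)
    (hZ : br w (Phi p (oZ p)) ∈ ASub p) (a : ODan p) : br w (Phi p a) ∈ ASub p := by
  induction a using ODan_induction with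
  | hC c => rw [AlgHom.commutes, br_C]; exact zero_mem _
  | add a b ha hb => rw [map_add, br_add]; exact add_mem ha hb
  | mulX a ha => rw [map_mul, br_mul]; exact add_mem (mul_mem (Phi_mem _) ha) (mul_mem (Phi_mem _) hX)
  | mulY a ha => rw [map_mul, br_mul]; exact add_mem (mul_mem (Phi_mem _) ha) (mul_mem (Phi_mem _) hY)
  | mulZ a ha => rw [map_mul, br_mul]; exact add_mem (mul_mem (Phi_mem _) ha) (mul_mem (Phi_mem _) hZ)

lemma br_xy : br (Phi p (oX p)) (Phi p (oY p)) = mon 0 (derivative p) := by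
  simp [br_mon]
lemma br_xz : br (Phi p (oX p)) (Phi p (oZ p)) = Phi p (oX p) := by
  simp [br_mon]
lemma br_zy : br (Phi p (oZ p)) (Phi p (oY p)) = Phi p (oY p) := by
  simp [br_mon]

lemma mon0_mem (a : ℂ[X]) : mon 0 a ∈ ASub p := by
  rw [← Phi_aeval]; exact Phi_mem _

lemma br_mem (a b : ODan p) : br (Phi p a) (Phi p b) ∈ ASub p := by
  have hXY : br (Phi p (oX p)) (Phi p (oY p)) ∈ ASub p := by rw [br_xy]; exact mon0_mem _
  have hXZ : br (Phi p (oX p)) (Phi p (oZ p)) ∈ ASub p := by rw [br_xz]; exact Phi_mem _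
  have hZY : br (Phi p (oZ p)) (Phi p (oY p)) ∈ ASub p := by rw [br_zy]; exact Phi_mem _
  have hs : ∀ f g : LR, br f g ∈ ASub p → br g f ∈ ASub p := by
    intro f g h; rw [br_skew]; exact neg_mem h
  have h0 : ∀ f : LR, br f f ∈ ASub p := by intro f; rw [br_self]; exact zero_mem _
  apply Phi_br_aux
  · apply hs; exact Phi_br_aux _ (h0 _) hXY hXZ a
  · apply hs; exact Phi_br_aux _ (hs _ _ hXY) (h0 _) (hs _ _ hZY) a
  · apply hs; exact Phi_br_aux _ (hs _ _ hXZ) hZY (h0 _) a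

lemma br_mem' {f g : LR} (hf : f ∈ ASub p) (hg : g ∈ ASub p) : br f g ∈ ASub p := by
  obtain ⟨a, rfl⟩ := Phi_surj hf
  obtain ⟨b, rfl⟩ := Phi_surj hg
  exact br_mem a b

/-- Bracket on `O`. -/
def obr (a b : ODan p) : ODan p := Classical.choose (Phi_surj (br_mem a b))
lemma Phi_obr (a b : ODan p) : Phi p (obr a b) = br (Phi p a) (Phi p b) :=
  Classical.choose_spec (Phi_surj (br_mem a b))

variable (p0 : p ≠ 0)

def Ham (a : ODan p) : Derivation ℂ (ODan p) (ODan p) := Derivation.mk'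
  { toFun := fun b => obr a b
    map_add' := fun b c => Phi_inj p0 (by simp only [map_add, Phi_obr, br_add])
    map_smul' := fun c b => Phi_inj p0 (by simp only [map_smul, Phi_obr, br_smul, RingHom.id_apply]) } (by
  intro b c
  apply Phi_inj p0
  change Phi p (obr a (b*c)) = Phi p (b * obr a c + c * obr a b)
  simp only [map_mul, map_add, Phi_obr, br_mul])

lemma Phi_Ham (a b : ODan p) : Phi p (Ham p0 a b) = br (Phi p a) (Phi p b) := Phi_obr a b

lemma Ham_add (a b : ODan p) : Ham p0 (a+b) = Ham p0 a + Ham p0 b := by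
  ext c
  apply Phi_inj p0
  simp only [Derivation.add_apply, map_add, Phi_Ham, add_br]
lemma Ham_smul (c : ℂ) (a : ODan p) : Ham p0 (c • a) = c • Ham p0 a := by
  ext b
  apply Phi_inj p0
  rw [Derivation.smul_apply]
  simp only [map_smul, Phi_Ham, smul_br]
lemma Ham_C (c : ℂ) : Ham p0 (algebraMap ℂ _ c) = 0 := by
  ext b
  apply Phi_inj p0
  simp only [Phi_Ham, AlgHom.commutes, C_br, Derivation.zero_apply, map_zero]

def HamL : ODan p →ₗ[ℂ] Derivation ℂ (ODan p) (ODan p) where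
  toFun := Ham p0
  map_add' := Ham_add p0
  map_smul' := Ham_smul p0

lemma Ham_skew (a b : ODan p) : Ham p0 a b = - Ham p0 b a := by
  apply Phi_inj p0
  rw [map_neg, Phi_Ham, Phi_Ham, br_skew]

lemma Ham_lie (a b : ODan p) : ⁅Ham p0 a, Ham p0 b⁆ = Ham p0 (Ham p0 a b) := by
  ext c
  apply Phi_inj p0
  rw [Derivation.commutator_apply]
  simp only [map_sub, Phi_Ham, br_jacobi]

lemma Ham_xy : Ham p0 (oX p) (oY p) = aeval (oZ p) (derivative p) := by
  apply Phi_inj p0; rw [Phi_Ham, br_xy, Phi_aeval]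
lemma Ham_xz : Ham p0 (oX p) (oZ p) = oX p := by
  apply Phi_inj p0; rw [Phi_Ham, br_xz]
lemma Ham_zy : Ham p0 (oZ p) (oY p) = oY p := by
  apply Phi_inj p0; rw [Phi_Ham, br_zy]
lemma Ham_self (a : ODan p) : Ham p0 a a = 0 := by
  apply Phi_inj p0; rw [Phi_Ham, br_self, map_zero]

variable (p) in
def sig : ODan p →ₐ[ℂ] ODan p := oLift (oY p) (oX p) (oZ p) (by rw [mul_comm, oX_mul_oY])
@[simp] lemma sig_X : sig p (oX p) = oY p := oLift_X ..
@[simp] lemma sig_Y : sig p (oY p) = oX p := oLift_Y ..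
@[simp] lemma sig_Z : sig p (oZ p) = oZ p := oLift_Z ..
lemma sig_aeval (g : ℂ[X]) : sig p (aeval (oZ p) g) = aeval (oZ p) g := by
  rw [← Polynomial.aeval_algHom_apply, sig_Z]
@[simp] lemma sig_xg (i : ℕ) (g : ℂ[X]) : sig p (xg p i g) = yg p i g := by
  simp only [xg, yg, map_mul, map_pow, sig_X, sig_aeval]
@[simp] lemma sig_yg (i : ℕ) (g : ℂ[X]) : sig p (yg p i g) = xg p i g := by
  simp only [xg, yg, map_mul, map_pow, sig_Y, sig_aeval]
@[simp] lemma sig_sig (a : ODan p) : sig p (sig p a) = a := by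
  induction a using oSpan with
  | add a b ha hb => simp only [map_add, ha, hb]
  | hx i g => simp
  | hy i g => simp

lemma sig_Ham_aux (a : ODan p) (hX : Ham p0 (sig p a) (sig p (oX p)) = - sig p (Ham p0 a (oX p)))
    (hY : Ham p0 (sig p a) (sig p (oY p)) = - sig p (Ham p0 a (oY p)))
    (hZ : Ham p0 (sig p a) (sig p (oZ p)) = - sig p (Ham p0 a (oZ p))) (b : ODan p) :
    Ham p0 (sig p a) (sig p b) = - sig p (Ham p0 a b) := by
  induction b using ODan_induction with
  | hC c => simp
  | add b c hb hc => simp only [map_add, hb, hc, neg_add]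
  | mulX b hb => simp only [map_mul, Derivation.leibniz, smul_eq_mul, map_add, hb, hX]; ring
  | mulY b hb => simp only [map_mul, Derivation.leibniz, smul_eq_mul, map_add, hb, hY]; ring
  | mulZ b hb => simp only [map_mul, Derivation.leibniz, smul_eq_mul, map_add, hb, hZ]; ring

lemma sig_Ham (a b : ODan p) : Ham p0 (sig p a) (sig p b) = - sig p (Ham p0 a b) := by
  have hs : ∀ a b : ODan p, Ham p0 (sig p a) (sig p b) = - sig p (Ham p0 a b) →
    Ham p0 (sig p b) (sig p a) = - sig p (Ham p0 b a) := by
    intro a b h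
    rw [Ham_skew, h, Ham_skew p0 b a, map_neg]
  have h0 : ∀ a : ODan p, Ham p0 (sig p a) (sig p a) = - sig p (Ham p0 a a) := by
    intro a; rw [Ham_self, Ham_self]; simp
  have hXY : Ham p0 (sig p (oX p)) (sig p (oY p)) = - sig p (Ham p0 (oX p) (oY p)) := by
    rw [sig_X, sig_Y, Ham_skew, Ham_xy, sig_aeval]
  have hXZ : Ham p0 (sig p (oX p)) (sig p (oZ p)) = - sig p (Ham p0 (oX p) (oZ p)) := by
    rw [sig_X, sig_Z, Ham_skew, Ham_xz, Ham_zy, sig_X]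
  have hZY : Ham p0 (sig p (oZ p)) (sig p (oY p)) = - sig p (Ham p0 (oZ p) (oY p)) := by
    rw [sig_Y, sig_Z, Ham_skew, Ham_xz, Ham_zy, sig_Y]
  apply sig_Ham_aux
  · apply hs; exact sig_Ham_aux p0 _ (h0 _) hXY hXZ a
  · apply hs; exact sig_Ham_aux p0 _ (hs _ _ hXY) (h0 _) (hs _ _ hZY) a
  · apply hs; exact sig_Ham_aux p0 _ (hs _ _ hXZ) hZY (h0 _) a

lemma cf_sig (a : ODan p) (i : ℕ) : cf (-i) (Phi p (sig p a)) = p^i * cf i (Phi p a) ∧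
    p^i * cf i (Phi p (sig p a)) = cf (-i) (Phi p a) := by
  induction a using oSpan with
  | add a b ha hb => simp only [map_add, ha.1, ← ha.2, hb.1, ← hb.2, mul_add, and_self]
  | hx j g =>
    rw [sig_xg, Phi_xg, Phi_yg]
    simp only [cf_mon]
    constructor
    · by_cases h : i = j
      · subst h; simp
      · rw [if_neg (by omega), if_neg (by omega), mul_zero]
    · by_cases h : i = 0 ∧ j = 0
      · rw [h.1, h.2]; simp
      · rw [if_neg (by omega), if_neg (by omega), mul_zero]
  | hy j g =>
    rw [sig_yg, Phi_xg, Phi_yg]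
    simp only [cf_mon]
    constructor
    · by_cases h : i = 0 ∧ j = 0
      · rw [h.1, h.2]; simp
      · rw [if_neg (by omega), if_neg (by omega), mul_zero]
    · by_cases h : i = j
      · subst h; simp
      · rw [if_neg (by omega), if_neg (by omega), mul_zero]

lemma iterate_Ham (a b : ODan p) (n : ℕ) : Phi p ((Ham p0 a)^[n] b) = (br (Phi p a))^[n] (Phi p b) := by
  induction n with
  | zero => rfl
  | succ n ih => rw [Function.iterate_succ_apply', Function.iterate_succ_apply', Phi_Ham, ih]

lemma iterate_sig (a b : ODan p) (n : ℕ) : (Ham p0 (sig p a))^[n] (sig p b) =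
    sig p ((Ham p0 a)^[n] b) ∨ (Ham p0 (sig p a))^[n] (sig p b) = - sig p ((Ham p0 a)^[n] b) := by
  induction n with
  | zero => simp
  | succ n ih =>
    rw [Function.iterate_succ_apply', Function.iterate_succ_apply']
    rcases ih with h | h
    · right; rw [h, sig_Ham]
    · left; rw [h, map_neg, sig_Ham, neg_neg]

lemma LND_iff (δ : Derivation ℂ (ODan p) (ODan p)) : IsLND δ ↔ ∀ f, ∃ n, δ^[n] f = 0 := by
  have h : ∀ (n : ℕ) f, (δ.toLinearMap ^ n) f = δ^[n] f := by
    intro n f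
    rw [Module.End.pow_apply]; rfl
  constructor
  · intro hh f
    obtain ⟨n, -, hn⟩ := hh f
    exact ⟨n, by rw [← h, hn]⟩
  · intro hh f
    obtain ⟨n, hn⟩ := hh f
    refine ⟨n+1, by omega, ?_⟩
    rw [h, Function.iterate_succ_apply', hn, map_zero]

lemma LND_sig (a : ODan p) (h : IsLND (Ham p0 a)) : IsLND (Ham p0 (sig p a)) := by
  rw [LND_iff] at h ⊢
  intro f
  obtain ⟨n, hn⟩ := h (sig p f)
  refine ⟨n, ?_⟩
  have := iterate_sig p0 a (sig p f) n
  rw [hn, sig_sig, map_zero, neg_zero, or_self] at this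
  exact this

end


section
variable {p : ℂ[X]}

/-- extension of a derivation to `LR`. -/
def uu (δ : Derivation ℂ (ODan p) (ODan p)) : LR := mon (-1) 1 * Phi p (δ (oX p))
def vv (δ : Derivation ℂ (ODan p) (ODan p)) : LR := Phi p (δ (oZ p))
def dR (δ : Derivation ℂ (ODan p) (ODan p)) : Derivation ℂ LR LR := uu δ • Eu + vv δ • Dz

lemma dR_apply (δ : Derivation ℂ (ODan p) (ODan p)) (f : LR) :
    dR δ f = uu δ * Eu f + vv δ * Dz f := rfl

lemma mon_one_ne : (mon 1 1 : LR) ≠ 0 := by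
  intro h
  have := cf_mon_same 1 1
  rw [h, map_zero] at this
  exact zero_ne_one this

lemma mon_cancel : (mon (-1) 1 : LR) * mon 1 1 = 1 := by
  rw [mon_mul, one_eq_mon]; simp

lemma Phi_d (δ : Derivation ℂ (ODan p) (ODan p)) (a : ODan p) : Phi p (δ a) = dR δ (Phi p a) := by
  have hX : Phi p (δ (oX p)) = dR δ (Phi p (oX p)) := by
    rw [dR_apply, uu, Phi_X, Eu_mon, Dz_mon]
    simp only [Int.cast_one, one_smul, derivative_one, map_zero, mul_zero, add_zero]
    linear_combination (- Phi p (δ (oX p))) * mon_cancel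
  have hZ : Phi p (δ (oZ p)) = dR δ (Phi p (oZ p)) := by
    rw [dR_apply, vv, Phi_Z, Eu_mon, Dz_mon]
    simp only [Int.cast_zero, zero_smul, derivative_X, ← one_eq_mon, mul_zero, zero_add, mul_one]
  have hY : Phi p (δ (oY p)) = dR δ (Phi p (oY p)) := by
    have h1 := congrArg (fun a => Phi p (δ a)) (oX_mul_oY (p := p))
    have h2 := congrArg (fun a => dR δ (Phi p a)) (oX_mul_oY (p := p))
    rw [Derivation.map_aeval, Derivation.leibniz] at h1
    rw [← Polynomial.aeval_algHom_apply, Derivation.map_aeval, map_mul, Derivation.leibniz] at h2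
    simp only [smul_eq_mul, map_mul, map_add, ← Polynomial.aeval_algHom_apply] at h1 h2
    rw [← hZ, ← h1, ← hX] at h2
    have h3 : Phi p (oX p) * (Phi p (δ (oY p)) - dR δ (Phi p (oY p))) = 0 := by
      linear_combination -h2
    rcases mul_eq_zero.mp h3 with h | h
    · rw [Phi_X] at h; exact absurd h mon_one_ne
    · exact sub_eq_zero.mp h
  induction a using ODan_induction with
  | hC c => simp only [AlgHom.commutes, Derivation.map_algebraMap, map_zero]
  | add a b ha hb => simp only [map_add, ha, hb]
  | mulX a ha => simp only [map_mul, Derivation.leibniz, smul_eq_mul, map_add, ha, hX]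
  | mulY a ha => simp only [map_mul, Derivation.leibniz, smul_eq_mul, map_add, ha, hY]
  | mulZ a ha => simp only [map_mul, Derivation.leibniz, smul_eq_mul, map_add, ha, hZ]

def kap (δ : Derivation ℂ (ODan p) (ODan p)) : LR := Eu (uu δ) + Dz (vv δ)

lemma kap_br (δ : Derivation ℂ (ODan p) (ODan p)) (f g : LR) :
    br (dR δ f) g + br f (dR δ g) - dR δ (br f g) = kap δ * br f g := by
  simp only [br, dR_apply, kap, map_add, map_sub, Derivation.leibniz, smul_eq_mul, Eu_Dz]
  ring

lemma kap_mem_aux (δ : Derivation ℂ (ODan p) (ODan p)) (a b : ODan p) :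
    kap δ * br (Phi p a) (Phi p b) ∈ ASub p := by
  rw [← kap_br, ← Phi_d, ← Phi_d]
  obtain ⟨c, hc⟩ := Phi_surj (br_mem a b)
  rw [← hc, ← Phi_d]
  exact sub_mem (add_mem (br_mem _ _) (br_mem _ _)) (Phi_mem _)

lemma kap_mem (hp : IsCoprime p (derivative p)) (δ : Derivation ℂ (ODan p) (ODan p)) :
    kap δ ∈ ASub p := by
  obtain ⟨s, t, hst⟩ := hp
  have h1 := kap_mem_aux δ (oX p) (oZ p)
  have h2 := kap_mem_aux δ (oX p) (oY p)
  rw [br_xz] at h1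
  rw [br_xy] at h2
  have h3 : kap δ = mon 0 s * Phi p (oY p) * (kap δ * Phi p (oX p)) + mon 0 t * (kap δ * mon 0 (derivative p)) := by
    have e1 : mon 0 s * Phi p (oY p) * Phi p (oX p) + mon 0 t * mon 0 (derivative p) = 1 := by
      rw [mul_assoc, ← map_mul, mul_comm (oY p), oX_mul_oY, Phi_aeval, mon_mul, mon_mul, one_eq_mon]
      simp only [add_zero, ← map_add, hst]
    linear_combination (-kap δ) * e1
  rw [h3]
  exact add_mem (mul_mem (mul_mem (mon0_mem _) (Phi_mem _)) h1) (mul_mem (mon0_mem _) h2)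

lemma leibniz_top {R : Type*} [CommRing R] [Algebra ℂ R] (δ : Derivation ℂ R R) (N : ℕ) :
    ∀ n m : ℕ, n + m = N → ∀ a b : R, δ^[n+1] a = 0 → δ^[m+1] b = 0 →
    ∃ c : ℕ, c ≠ 0 ∧ δ^[N] (a * b) = c * (δ^[n] a * δ^[m] b) := by
  have hadd : ∀ n : ℕ, ∀ a b, δ^[n] (a+b) = δ^[n] a + δ^[n] b := by
    intro n
    induction n with
    | zero => simp
    | succ n ih => intro a b; rw [Function.iterate_succ_apply, map_add, ih]; rfl
  induction N with
  | zero =>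
    intro n m h a b _ _
    obtain ⟨rfl, rfl⟩ : n = 0 ∧ m = 0 := by omega
    exact ⟨1, one_ne_zero, by simp⟩
  | succ N ih =>
    intro n m h a b ha hb
    rw [Function.iterate_succ_apply, Derivation.leibniz, hadd]
    simp only [smul_eq_mul]
    have z : ∀ k : ℕ, δ^[k] (0:R) = 0 := by
      intro k
      induction k with
      | zero => rfl
      | succ k ih => rw [Function.iterate_succ_apply, map_zero, ih]
    rcases n with _ | n
    · rcases m with _ | m
      · omega
      · simp only [zero_add, Function.iterate_one] at ha
        rw [ha, mul_zero, z, add_zero]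
        obtain ⟨c, hc, h1⟩ := ih 0 m (by omega) a (δ b) (by simpa using ha) hb
        exact ⟨c, hc, h1⟩
    · rcases m with _ | m
      · simp only [zero_add, Function.iterate_one] at hb
        rw [hb, mul_zero, z, zero_add]
        obtain ⟨c, hc, h1⟩ := ih 0 n (by omega) b (δ a) (by simpa using hb) ha
        refine ⟨c, hc, ?_⟩
        rw [h1, Function.iterate_succ_apply]; simp only [Function.iterate_zero, id]; ring
      · obtain ⟨c, hc, h1⟩ := ih (n+1) m (by omega) a (δ b) ha hb
        obtain ⟨c', hc', h1'⟩ := ih (m+1) n (by omega) b (δ a) hb ha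
        refine ⟨c + c', by omega, ?_⟩
        rw [h1, h1']
        simp only [Function.iterate_succ_apply]
        push_cast; ring

lemma exists_top {M : Type*} [Zero M] (D : M → M) (w : M) (hw : w ≠ 0) (h : ∃ n, D^[n] w = 0) :
    ∃ n, D^[n] w ≠ 0 ∧ D^[n+1] w = 0 := by
  classical
  have h1 := Nat.find_spec h
  have h2 : Nat.find h ≠ 0 := by
    intro h0; rw [h0] at h1; exact hw h1
  obtain ⟨m, hm⟩ := Nat.exists_eq_succ_of_ne_zero h2
  refine ⟨m, Nat.find_min h (by omega), ?_⟩
  rw [hm] at h1; exact h1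

lemma kap_zero (p0 : p ≠ 0) (hp : IsCoprime p (derivative p)) (δ : Derivation ℂ (ODan p) (ODan p))
    (hδ : IsLND δ) : kap δ = 0 := by
  rw [LND_iff] at hδ
  obtain ⟨k, hk⟩ := Phi_surj (kap_mem hp δ)
  have : IsDomain (ODan p) := (Phi_inj p0).isDomain (Phi p).toRingHom
  have hD1 : ∀ a b : ODan p, δ (Ham p0 a b) + k * Ham p0 a b = Ham p0 (δ a) b + Ham p0 a (δ b) := by
    intro a b
    apply Phi_inj p0
    rw [map_add, map_mul, hk, map_add, Phi_Ham, Phi_Ham, Phi_Ham, Phi_d, Phi_Ham, Phi_d, Phi_d, ← kap_br]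
    ring
  let D : ODan p → ODan p := fun w => δ w + k * w
  have Dadd : ∀ n : ℕ, ∀ a b, D^[n] (a+b) = D^[n] a + D^[n] b := by
    intro n
    induction n with
    | zero => simp
    | succ n ih =>
      intro a b
      rw [Function.iterate_succ_apply, show D (a+b) = D a + D b by simp only [D, map_add]; ring, ih]; rfl
  have D0 : ∀ n : ℕ, D^[n] 0 = 0 := by
    intro n
    induction n with
    | zero => rfl
    | succ n ih => rw [Function.iterate_succ_apply, show D 0 = 0 by simp [D], ih]
  have Dn : ∀ N : ℕ, ∀ i j, i + j = N → ∀ a b, δ^[i] a = 0 → δ^[j] b = 0 → D^[N] (Ham p0 a b) = 0 := by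
    intro N
    induction N with
    | zero =>
      intro i j h a b ha hb
      obtain ⟨rfl, rfl⟩ : i = 0 ∧ j = 0 := by omega
      simp only [Function.iterate_zero, id] at ha hb ⊢
      rw [hb, map_zero]
    | succ N ih =>
      intro i j h a b ha hb
      have ea : i = 0 → D^[N+1] (Ham p0 a b) = 0 := by
        rintro rfl
        simp only [Function.iterate_zero, id] at ha
        rw [ha, Ham_skew, map_zero, neg_zero, D0]
      have eb : j = 0 → D^[N+1] (Ham p0 a b) = 0 := by
        rintro rfl
        simp only [Function.iterate_zero, id] at hb
        rw [hb, map_zero, D0]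
      rcases i with _ | i
      · exact ea rfl
      rcases j with _ | j
      · exact eb rfl
      rw [Function.iterate_succ_apply, show D (Ham p0 a b) = Ham p0 (δ a) b + Ham p0 a (δ b) from hD1 a b, Dadd,
        ih i (j+1) (by omega) _ _ ha hb, ih (i+1) j (by omega) _ _ ha hb, add_zero]
  have hx0 : oX p ≠ 0 := by
    intro h
    have := congrArg (Phi p) h
    rw [Phi_X, map_zero] at this
    exact mon_one_ne this
  obtain ⟨i, hi⟩ := hδ (oX p)
  obtain ⟨j, hj⟩ := hδ (oZ p)
  have hx : D^[i+j] (oX p) = 0 := by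
    have := Dn (i+j) i j rfl _ _ hi hj
    rwa [Ham_xz] at this
  obtain ⟨n0, h1, h2⟩ := exists_top D (oX p) hx0 ⟨_, hx⟩
  set u0 := D^[n0] (oX p) with hu0
  rw [Function.iterate_succ_apply', ← hu0] at h2
  by_contra hk0
  have hk1 : k ≠ 0 := by
    rintro rfl; rw [map_zero] at hk; exact hk0 hk.symm
  obtain ⟨n, hn, hn'⟩ := exists_top δ u0 h1 (hδ u0)
  obtain ⟨m, hm, hm'⟩ := exists_top δ k hk1 (hδ k)
  obtain ⟨c, hc, h3⟩ := leibniz_top δ (m+n) m n rfl k u0 hm' hn'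
  have h4 : k * u0 = δ (-u0) := by
    simp only [D] at h2
    rw [map_neg]; linear_combination h2
  have h5 : δ^[m+n] (k * u0) = 0 := by
    rw [h4, ← Function.iterate_succ_apply δ, show (m+n).succ = m + (n+1) by omega, Function.iterate_add_apply]
    have neg : ∀ r : ℕ, ∀ w, δ^[r] (-w) = - δ^[r] w := by
      intro r
      induction r with
      | zero => simp
      | succ r ih => intro w; rw [Function.iterate_succ_apply, map_neg, ih]; rfl
    have z : ∀ r : ℕ, δ^[r] 0 = 0 := by
      intro k
      induction k with
      | zero => rfl
      | succ k ih => rw [Function.iterate_succ_apply, map_zero, ih]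
    rw [neg, hn', neg_zero, z]
  rw [h5] at h3
  have hc' : (c : ODan p) ≠ 0 := by
    have : CharZero (ODan p) := charZero_of_injective_algebraMap (algebraMap ℂ (ODan p)).injective
    exact_mod_cast hc
  exact (mul_ne_zero hc' (mul_ne_zero hm hn)) h3.symm

lemma LND_is_Ham (p0 : p ≠ 0) (hd : 2 ≤ p.natDegree) (hp : IsCoprime p (derivative p))
    (δ : Derivation ℂ (ODan p) (ODan p)) (hδ : IsLND δ) : ∃ a, δ = Ham p0 a := by
  have hk := kap_zero p0 hp δ hδ
  have hi : ∀ i : ℤ, (i:ℂ) • cf i (uu δ) + derivative (cf i (vv δ)) = 0 := by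
    intro i
    have := congrArg (cf i) hk
    rwa [kap, map_add, cf_Eu, cf_Dz, map_zero] at this
  have hv0 : cf 0 (vv δ) = 0 := by
    have h0 := hi 0
    simp only [Int.cast_zero, zero_smul, zero_add] at h0
    have h1 := derivative_eq_zero.mp h0
    rw [natDegree_eq_zero] at h1
    obtain ⟨c, hc⟩ := h1
    have h2 := (Phi_mem (δ (oY p))) (-1)
    rw [Phi_d, dR_apply, Phi_Y, Eu_mon, Dz_mon, mul_comm, mul_comm (vv δ), map_add, smul_mul_assoc, map_smul,
      cf_mon_mul, cf_mon_mul, sub_self, ← hc] at h2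
    norm_num at h2
    have h3 : p ∣ derivative p * C c := by
      have := dvd_add h2 (dvd_mul_right p (cf 0 (uu δ)))
      rwa [neg_add_cancel_comm] at this
    have h4 : p ∣ C c := hp.dvd_of_dvd_mul_left h3
    by_contra hne
    rw [← hc] at hne
    have := natDegree_le_of_dvd h4 hne
    rw [natDegree_C] at this
    omega
  obtain ⟨f0, hf0⟩ := exists_antideriv (- cf 0 (uu δ))
  let f : LR := liftL (fun i => ((i:ℂ)⁻¹) • mon i) (vv δ) + mon 0 f0
  have hcf : ∀ i, cf i f = ((i:ℂ)⁻¹) • cf i (vv δ) + if 0 = i then f0 else 0 := by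
    intro i
    simp only [f, map_add, cf_mon]
    congr 1
    generalize vv δ = v
    induction v using LR_induction with
    | add f g hf hg => simp only [map_add, hf, hg, smul_add]
    | hm j a =>
      rw [liftL_mon, LinearMap.smul_apply, map_smul, cf_mon]
      split_ifs with h
      · rw [h]
      · simp
  have hE : Eu f = vv δ := by
    apply LR_ext; intro i
    rw [cf_Eu, hcf]
    by_cases h : i = 0
    · subst h; rw [hv0]; simp
    · rw [if_neg (Ne.symm h), add_zero, smul_inv_smul₀ (by exact_mod_cast h)]
  have hD : Dz f = - uu δ := by
    apply LR_ext; intro i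
    rw [cf_Dz, hcf]
    by_cases h : i = 0
    · subst h; rw [hv0]; simp [hf0]
    · rw [if_neg (Ne.symm h), add_zero, derivative_smul, eq_neg_of_add_eq_zero_right (hi i), smul_neg,
        inv_smul_smul₀ (by exact_mod_cast h), map_neg]
  have hfA : f ∈ ASub p := by
    intro i
    rw [hcf]
    apply dvd_add
    · rw [smul_eq_C_mul]; exact Dvd.dvd.mul_left (Phi_mem (δ (oZ p)) i) _
    · split_ifs with h
      · subst h; simp
      · simp
  obtain ⟨a, ha⟩ := Phi_surj hfA
  refine ⟨a, ?_⟩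
  ext b
  apply Phi_inj p0
  rw [Phi_Ham, ha, Phi_d, dR_apply, br, hE, hD]
  ring
end


section
variable {p : ℂ[X]}

/-- the automorphism `z ↦ z + c x^κ` -/
def phi (c : ℂ) (κ : ℕ) : LR →ₐ[ℂ] LR := Psi 1 (mon 0 X + mon κ (C c))

lemma phi_br (c : ℂ) (κ : ℕ) (f g : LR) : phi c κ (br f g) = br (phi c κ f) (phi c κ g) := by
  rw [phi, br_Psi, map_add, Dz_mon, Dz_mon, derivative_X, derivative_C, map_zero, add_zero, ← one_eq_mon]
  simp

lemma phi_T (c : ℂ) (κ : ℕ) (i : ℤ) : phi c κ (mon i 1) = mon i 1 := by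
  rw [phi, Psi_mon]; simp

lemma phi_z (c : ℂ) (κ : ℕ) (a : ℂ[X]) : phi c κ (mon 0 a) = aeval (mon 0 X + mon κ (C c)) a := by
  rw [phi, Psi_mon, mul_zero, ← one_eq_mon, mul_one]

lemma mon_C (i : ℤ) (c : ℂ) : mon i (C c) = c • mon i 1 := by
  rw [← mul_one (C c), mon_C_mul]

lemma phi_comp (c : ℂ) (κ : ℕ) (f : LR) : phi c κ (phi (-c) κ f) = f := by
  have : (phi c κ).comp (phi (-c) κ) = AlgHom.id ℂ LR := by
    apply _root_.algHom_ext
    · simp only [AlgHom.comp_apply, phi_z, aeval_X, map_add, AlgHom.id_apply, mon_C, map_smul, phi_T]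
      simp
    · simp only [AlgHom.comp_apply, phi_T, AlgHom.id_apply]
  exact congrArg (fun F => F f) this

lemma phi_mem (c : ℂ) (κ : ℕ) (hκ : 1 ≤ κ) {f : LR} (hf : f ∈ ASub p) : phi c κ f ∈ ASub p := by
  obtain ⟨a, rfl⟩ := Phi_surj hf
  have hX : phi c κ (Phi p (oX p)) ∈ ASub p := by
    have h := Phi_mem (oX p); rw [Phi_X] at h ⊢; rwa [phi_T]
  have eZ : phi c κ (Phi p (oZ p)) = Phi p (oZ p + algebraMap ℂ (ODan p) c * oX p ^ κ) := by
    rw [Phi_Z, phi_z, aeval_X, map_add, Phi_Z, map_mul, AlgHom.commutes, ← Algebra.smul_def, map_pow, Phi_X, mon_pow, mon_C]; simp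
  have hZ : phi c κ (Phi p (oZ p)) ∈ ASub p := by rw [eZ]; exact Phi_mem _
  have hY : phi c κ (Phi p (oY p)) ∈ ASub p := by
    have hdvd : oX p ∣ aeval (oZ p + algebraMap ℂ (ODan p) c * oX p ^ κ) p - aeval (oZ p) p := by
      have hd0 := Polynomial.sub_dvd_eval_sub (oZ p + algebraMap ℂ (ODan p) c * oX p ^ κ) (oZ p) (p.map (algebraMap ℂ (ODan p)))
      rw [eval_map_algebraMap, eval_map_algebraMap] at hd0
      refine dvd_trans ?_ hd0
      rw [add_sub_cancel_left]
      exact Dvd.dvd.mul_left (dvd_pow_self _ (by omega)) _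
    obtain ⟨q, hq⟩ := hdvd
    have h1 : phi c κ (Phi p (oY p)) = Phi p (oY p + q) := by
      have h2 : mon 1 1 * phi c κ (Phi p (oY p)) = mon 1 1 * Phi p (oY p + q) := by
        have e : (mon 1 1 : LR) = phi c κ (Phi p (oX p)) := by rw [Phi_X, phi_T]
        conv_lhs => rw [e]
        rw [← map_mul, ← map_mul, oX_mul_oY, ← Polynomial.aeval_algHom_apply, ← Polynomial.aeval_algHom_apply, eZ,
          Polynomial.aeval_algHom_apply, ← Phi_X (p := p), ← map_mul, mul_add, oX_mul_oY, ← hq]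
        congr 1; ring
      exact mul_left_cancel₀ mon_one_ne h2
    rw [h1]; exact Phi_mem _
  induction a using ODan_induction with
  | hC c => rw [AlgHom.commutes, AlgHom.commutes]; exact Subalgebra.algebraMap_mem _ _
  | add a b ha hb => rw [map_add, map_add]; exact add_mem (ha (Phi_mem _)) (hb (Phi_mem _))
  | mulX a ha => rw [map_mul, map_mul]; exact mul_mem hX (ha (Phi_mem _))
  | mulY a ha => rw [map_mul, map_mul]; exact mul_mem hY (ha (Phi_mem _))
  | mulZ a ha => rw [map_mul, map_mul]; exact mul_mem hZ (ha (Phi_mem _))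

variable (p) in
def adLN (f : LR) : Prop := ∀ g ∈ ASub p, ∃ n, (br f)^[n] g = 0

lemma phi_adLN (c : ℂ) (κ : ℕ) (hκ : 1 ≤ κ) {f : LR} (hf : adLN p f) : adLN p (phi c κ f) := by
  intro g hg
  obtain ⟨n, hn⟩ := hf _ (phi_mem (-c) κ hκ hg)
  refine ⟨n, ?_⟩
  have : ∀ n g, (br (phi c κ f))^[n] (phi c κ g) = phi c κ ((br f)^[n] g) := by
    intro n g
    induction n with
    | zero => rfl
    | succ n ih => rw [Function.iterate_succ_apply', Function.iterate_succ_apply', ih, phi_br]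
  have h := this n (phi (-c) κ g)
  rwa [phi_comp, hn, map_zero] at h

lemma cf_phi_z (c : ℂ) (κ : ℕ) (hκ : 1 ≤ κ) (l : ℕ) (b : ℂ[X]) :
    cf (κ * l) (phi c κ (mon 0 b)) = C (c^l) * hasseDeriv l b := by
  rw [phi_z]
  induction b using Polynomial.induction_on' with
  | add p q hp hq => simp only [map_add, hp, hq, mul_add]
  | monomial m r =>
    rw [← C_mul_X_pow_eq_monomial, map_mul, aeval_C, map_pow, aeval_X, add_comm, add_pow, ← Algebra.smul_def,
      map_smul, map_sum]
    have : ∀ i, cf ((κ:ℤ) * l) (mon κ (C c)^i * mon 0 X ^ (m - i) * (m.choose i : LR)) =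
        if i = l then C (c^i) * X^(m-i) * (m.choose i : ℂ[X]) else 0 := by
      intro i
      have hn : (m.choose i : LR) = mon 0 (m.choose i : ℂ[X]) := by
        rw [← aeval_mon0]; simp
      rw [hn, mon_pow, mon_pow, mon_mul, mon_mul, cf_mon]
      by_cases h : i = l
      · subst h
        rw [if_pos (by ring), if_pos rfl, C_pow]
      · rw [if_neg h, if_neg]
        intro h2
        apply h
        have : (κ:ℤ) * i = κ * l := by linarith
        exact_mod_cast mul_left_cancel₀ (by positivity : (κ:ℤ) ≠ 0) this
    rw [Finset.sum_congr rfl (fun i _ => this i), Finset.sum_ite_eq',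
      show C r * X ^ m = monomial m r from C_mul_X_pow_eq_monomial, hasseDeriv_monomial]
    split_ifs with h
    · rw [← C_mul_X_pow_eq_monomial, smul_eq_C_mul, C_mul, map_natCast]; ring
    · rw [Finset.mem_range] at h
      rw [Nat.choose_eq_zero_of_lt (by omega)]; simp

lemma cf_phi_z_zero (c : ℂ) (κ : ℕ) (k : ℤ) (hk : ∀ l : ℕ, (κ:ℤ) * l ≠ k) (b : ℂ[X]) :
    cf k (phi c κ (mon 0 b)) = 0 := by
  rw [phi_z]
  induction b using Polynomial.induction_on' with
  | add p q hp hq => simp only [map_add, hp, hq, add_zero]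
  | monomial m r =>
    rw [← C_mul_X_pow_eq_monomial, map_mul, aeval_C, map_pow, aeval_X, add_comm, add_pow, ← Algebra.smul_def,
      map_smul, map_sum]
    rw [Finset.sum_eq_zero, smul_zero]
    intro i _
    have hn : (m.choose i : LR) = mon 0 (m.choose i : ℂ[X]) := by
      rw [← aeval_mon0]; simp
    rw [hn, mon_pow, mon_pow, mon_mul, mon_mul, cf_mon, if_neg]
    intro h2
    exact hk i (by linarith)

variable (p) in
def Good (f : LR) : Prop := ∃ c h, cf 0 f = C c + derivative (p * h)

lemma phi_good_aux (c : ℂ) (κ : ℕ) (hκ : 1 ≤ κ) {f : LR} (hf : f ∈ ASub p) :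
    ∃ h, cf 0 (phi c κ f) - cf 0 f = derivative (p * h) := by
  have hterm : ∀ i : ℤ, ∃ h, cf 0 (phi c κ (mon i (cf i f))) - cf 0 (mon i (cf i f)) = derivative (p * h) := by
    intro i
    have hdv := hf i
    generalize cf i f = b at *
    have e : phi c κ (mon i b) = mon i 1 * phi c κ (mon 0 b) := by
      rw [← phi_T c κ i, ← map_mul, mon_mul]; simp [phi_T]
    rw [e, cf_mon_mul, one_mul, cf_mon, zero_sub]
    by_cases hi : i = 0
    · subst hi
      have := cf_phi_z c κ hκ 0 b
      simp only [Nat.cast_zero, mul_zero, pow_zero, map_one, one_mul, hasseDeriv_zero'] at this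
      rw [neg_zero, this]
      exact ⟨0, by simp⟩
    · rw [if_neg hi, sub_zero]
      by_cases hl : ∃ l : ℕ, (κ:ℤ) * l = -i
      · obtain ⟨l, hl⟩ := hl
        rw [← hl, cf_phi_z c κ hκ]
        have hl0 : l ≠ 0 := by rintro rfl; simp at hl; omega
        obtain ⟨l, rfl⟩ := Nat.exists_eq_succ_of_ne_zero hl0
        have hle : l + 1 ≤ (-i).toNat := by
          have : ((l+1:ℕ):ℤ) ≤ κ * ((l+1:ℕ):ℤ) := le_mul_of_one_le_left (by positivity) (by exact_mod_cast hκ)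
          simp only [Nat.succ_eq_add_one] at hl
          omega
        have h1 := Polynomial.pow_sub_dvd_iterate_derivative_of_pow_dvd (p := b) l hdv
        have h2 : p ∣ derivative^[l] b := dvd_trans (dvd_pow_self p (by omega)) h1
        obtain ⟨q, hq⟩ := h2
        have h3 := factorial_smul_hasseDeriv (R := ℂ) (l+1)
        have h4 : ((l+1).factorial : ℂ) • hasseDeriv (l+1) b = derivative (p * q) := by
          have := congrFun h3 b
          rw [Function.iterate_succ_apply', hq] at this
          rw [← this, LinearMap.smul_apply, Nat.cast_smul_eq_nsmul]
        have hfac : ((l+1).factorial : ℂ) ≠ 0 := by exact_mod_cast (Nat.factorial_ne_zero _)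
        refine ⟨C (c^(l+1) * ((l+1).factorial : ℂ)⁻¹) * q, ?_⟩
        have h5 : p * (C (c^(l+1) * ((l+1).factorial : ℂ)⁻¹) * q) = C (c^(l+1) * ((l+1).factorial : ℂ)⁻¹) * (p * q) := by ring
        rw [h5, derivative_C_mul, ← h4, smul_eq_C_mul, ← mul_assoc, ← C_mul, mul_assoc (c^(l+1)), inv_mul_cancel₀ hfac, mul_one]
      · push Not at hl
        rw [cf_phi_z_zero c κ _ hl]
        exact ⟨0, by simp⟩
  choose h hh using hterm
  refine ⟨∑ i ∈ f.coeff.support, h i, ?_⟩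
  rw [Finset.mul_sum, derivative_sum, ← Finset.sum_congr rfl (fun i _ => hh i), Finset.sum_sub_distrib,
    ← map_sum, ← map_sum, ← map_sum, ← LR_sum]

lemma phi_good (c : ℂ) (κ : ℕ) (hκ : 1 ≤ κ) {f : LR} (hf : f ∈ ASub p) (h : Good p (phi c κ f)) : Good p f := by
  obtain ⟨h1, e1⟩ := phi_good_aux c κ hκ hf
  obtain ⟨c', h2, e2⟩ := h
  refine ⟨c', h2 - h1, ?_⟩
  rw [mul_sub, derivative_sub, ← e1, e2]; ring

lemma aeval_mon0' (a b : ℂ[X]) : aeval (mon 0 b) a = mon 0 (a.comp b) := by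
  rw [← aeval_mon0 b, ← aeval_mon0 (a.comp b), Polynomial.aeval_comp]

lemma Theta_phi (A : ℤ) (c : ℂ) (κ : ℕ) (f : LR) (k : ℤ) :
    cf k (Theta A (A * κ) (phi c κ f)) = (cf k (Theta A (A * κ) f)).comp (X + C c) := by
  have h1 : (Theta A (A*κ)).comp (phi c κ) = (Psi 1 (mon 0 (X + C c))).comp (Theta A (A*κ)) := by
    have tz : Theta A (A*κ) (mon 0 X) = mon (A*κ) X := by
      have := Theta_monomial A (A*κ) 0 1 1
      simpa [monomial_one_one_eq_X] using this
    have tt : ∀ i : ℤ, Theta A (A*κ) (mon i 1) = mon (A*i) 1 := by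
      intro i
      have := Theta_monomial A (A*κ) i 0 1
      simpa using this
    apply _root_.algHom_ext
    · simp only [AlgHom.comp_apply, phi_z, aeval_X, map_add, mon_C, map_smul, tz, tt, Psi_mon, mul_one, one_mul,
        aeval_X, map_add]
      rw [add_mul, mon_mul, smul_mul_assoc, mon_mul]
      simp
    · simp only [AlgHom.comp_apply, phi_T, tt, Psi_mon]
      simp
  have h2 : Theta A (A*κ) (phi c κ f) = Psi 1 (mon 0 (X + C c)) (Theta A (A*κ) f) := congrArg (fun F => F f) h1
  rw [h2]
  generalize Theta A (A*κ) f = g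
  induction g using LR_induction with
  | add f g hf hg =>
    have e1 := map_add (Psi 1 (mon 0 (X + C c))) f g
    rw [e1, (cf k).map_add, hf, hg, (cf k).map_add, add_comp]
  | hm i a =>
    rw [Psi_mon, aeval_mon0', mon_mul, cf_mon, cf_mon]
    by_cases h : i = k
    · rw [if_pos h, if_pos (by omega), mul_one]
    · rw [if_neg h, if_neg (by omega), zero_comp]
end


section
variable {p : ℂ[X]}

lemma lexmax {ι : Type*} (S : ι → Prop) (u v : ι → ℤ) (b1 b2 : ℤ) (hu : ∀ x, S x → u x ≤ b1)
    (hv : ∀ x, S x → v x ≤ b2) (hne : ∃ x, S x) :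
    ∃ x, S x ∧ ∀ y, S y → u y < u x ∨ (u y = u x ∧ v y ≤ v x) := by
  obtain ⟨x0, hx0⟩ := hne
  obtain ⟨U, ⟨x1, h1, e1⟩, hU⟩ := Int.exists_greatest_of_bdd (P := fun z => ∃ x, S x ∧ u x = z)
    ⟨b1, by rintro z ⟨x, hx, rfl⟩; exact hu x hx⟩ ⟨_, x0, hx0, rfl⟩
  obtain ⟨V, ⟨x2, h2, e2, e3⟩, hV⟩ := Int.exists_greatest_of_bdd (P := fun z => ∃ x, S x ∧ u x = U ∧ v x = z)
    ⟨b2, by rintro z ⟨x, hx, _, rfl⟩; exact hv x hx⟩ ⟨_, x1, h1, e1, rfl⟩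
  refine ⟨x2, h2, fun y hy => ?_⟩
  have a1 := hU (u y) ⟨y, hy, rfl⟩
  rcases lt_or_eq_of_le a1 with h | h
  · left; omega
  · right
    have a2 := hV (v y) ⟨y, hy, h, rfl⟩
    omega

variable (p) in
def HB (f : LR) (M N : ℕ) : Prop := ∀ (i : ℤ) (j : ℕ), (cf i f).coeff j ≠ 0 →
  (p.natDegree : ℤ) * i + j ≤ M ∧ (j : ℤ) ≤ N

lemma lead_nonneg (p0 : p ≠ 0) {f : LR} (hf : f ∈ ASub p) (i : ℤ) (h : cf i f ≠ 0) :
    0 ≤ (p.natDegree : ℤ) * i + (cf i f).natDegree := by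
  have h1 := natDegree_le_of_dvd (hf i) h
  rw [natDegree_pow] at h1
  rcases le_or_gt 0 i with hi | hi
  · positivity
  · have e : ((-i).toNat : ℤ) = -i := Int.toNat_of_nonneg (by omega)
    have h2 : (((-i).toNat * p.natDegree : ℕ) : ℤ) ≤ (cf i f).natDegree := by exact_mod_cast h1
    push_cast at h2
    rw [e] at h2
    nlinarith

lemma lead_nonneg' (p0 : p ≠ 0) {f : LR} (hf : f ∈ ASub p) (i : ℤ) (j : ℕ) (h : (cf i f).coeff j ≠ 0)
    (hj : ∀ k, j < k → (cf i f).coeff k = 0) : 0 ≤ (p.natDegree : ℤ) * i + j := by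
  have h0 : cf i f ≠ 0 := by rintro h0; rw [h0] at h; simp at h
  have h1 := lead_nonneg p0 hf i h0
  have h2 : (cf i f).natDegree = j := by
    apply le_antisymm
    · rw [natDegree_le_iff_coeff_eq_zero]; exact hj
    · exact le_natDegree_of_ne_zero h
  rwa [h2] at h1

lemma HB_lead {f : LR} {M N : ℕ} (h : HB p f M N) (i : ℤ) (h0 : cf i f ≠ 0) :
    (p.natDegree : ℤ) * i + (cf i f).natDegree ≤ M ∧ ((cf i f).natDegree : ℤ) ≤ N :=
  h i _ (by rw [coeff_natDegree]; exact leadingCoeff_ne_zero.2 h0)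

lemma single_root (F : ℂ[X]) (N : ℕ) (hN : 1 ≤ N) (hF : F.natDegree = N)
    (h : ∀ (c : ℂ) (r : ℕ) (F1 : ℂ[X]), F = (X - C c)^(r+1) * F1 → F1.eval c ≠ 0 → N < 2 * (r+1)) :
    ∃ c a, a ≠ 0 ∧ F = C a * (X - C c)^N := by
  have hF0 : F ≠ 0 := by rintro rfl; simp at hF; omega
  have dec : ∀ c, F.eval c = 0 → ∃ r F1, F = (X - C c)^(r+1) * F1 ∧ F1.eval c ≠ 0 := by
    intro c hc
    obtain ⟨q, h1, h2⟩ := exists_eq_pow_rootMultiplicity_mul_and_not_dvd F hF0 c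
    have h3 : 0 < rootMultiplicity c F := (rootMultiplicity_pos hF0).2 hc
    refine ⟨rootMultiplicity c F - 1, q, ?_, ?_⟩
    · rw [Nat.sub_add_cancel h3]; exact h1
    · rwa [dvd_iff_isRoot] at h2
  obtain ⟨c, hc⟩ := IsAlgClosed.exists_root F (by
    rw [degree_eq_natDegree hF0, hF]; exact_mod_cast (by omega : N ≠ 0))
  obtain ⟨r, q, h1, h2⟩ := dec c hc
  have h3 := h c r q h1 h2
  have hq0 : q ≠ 0 := by rintro rfl; simp at h2
  have hdeg : N = (r+1) + q.natDegree := by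
    rw [← hF, h1, natDegree_mul (pow_ne_zero _ (X_sub_C_ne_zero c)) hq0, natDegree_pow, natDegree_X_sub_C, mul_one]
  by_cases hq : q.natDegree = 0
  · obtain ⟨a, ha⟩ := natDegree_eq_zero.1 hq
    refine ⟨c, a, ?_, ?_⟩
    · rintro rfl; simp at ha; exact hq0 ha.symm
    · rw [h1, ← ha, mul_comm]; congr 2; omega
  · exfalso
    obtain ⟨c', hc'⟩ := IsAlgClosed.exists_root q (by
      rw [degree_eq_natDegree hq0]; exact_mod_cast hq)
    have hne : c ≠ c' := by rintro rfl; exact h2 hc'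
    obtain ⟨r', q', h4, h5⟩ := dec c' (by rw [h1, eval_mul, hc', mul_zero])
    have h6 := h c' r' q' h4 h5
    have hcop : IsCoprime ((X - C c)^(r+1)) ((X - C c')^(r'+1)) :=
      (isCoprime_X_sub_C_of_isUnit_sub (sub_ne_zero.2 hne).isUnit).pow
    have hd := natDegree_le_of_dvd (hcop.mul_dvd ⟨q, h1⟩ ⟨q', h4⟩) hF0
    rw [natDegree_mul (pow_ne_zero _ (X_sub_C_ne_zero c)) (pow_ne_zero _ (X_sub_C_ne_zero c')), natDegree_pow,
      natDegree_X_sub_C, natDegree_pow, natDegree_X_sub_C] at hd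
    omega

end


section
variable {p : ℂ[X]}

/-- All the edges: terms lie below the segment. -/
lemma edges (p0 : p ≠ 0) (hd : 1 ≤ p.natDegree) {f : LR} (hf : f ∈ ASub p)
    (hx : ∃ n, (br f)^[n] (mon 1 1) = 0) (hy : ∃ n, (br f)^[n] (mon (-1) p) = 0)
    (M N : ℕ) (hNM : N ≤ M) (hN : 1 ≤ N) (hB : HB p f M N)
    (t1 : ∃ i j, (cf i f).coeff j ≠ 0 ∧ (p.natDegree : ℤ) * i + j = M)
    (t2 : ∃ i j, (cf i f).coeff j ≠ 0 ∧ j = N) :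
    (∃ m, (cf m f).coeff 0 ≠ 0 ∧ (p.natDegree : ℤ) * m = M) ∧
    (∃ m, (cf m f).coeff N ≠ 0 ∧ (p.natDegree : ℤ) * m = -N) ∧
    (∀ (i : ℤ) (j : ℕ), (cf i f).coeff j ≠ 0 →
      (N:ℤ) * (p.natDegree * i + j) + M * j ≤ N * M) := by
  have hd' : (0:ℤ) < p.natDegree := by exact_mod_cast hd
  have hN' : (1:ℤ) ≤ N := by exact_mod_cast hN
  have hM' : (N:ℤ) ≤ M := by exact_mod_cast hNM
  have inj : ∀ (i i' : ℤ) (j j' : ℕ), (p.natDegree : ℤ) * i + j = p.natDegree * i' + j' → j = j' → i = i' := by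
    intro i i' j j' h1 h2
    subst h2
    exact mul_left_cancel₀ hd'.ne' (by linarith)
  let S : ℤ × ℕ → Prop := fun x => (cf x.1 f).coeff x.2 ≠ 0
  refine ⟨?_, ?_, ?_⟩
  · obtain ⟨⟨i0, j0⟩, h0, hmax⟩ := lexmax S (fun x => p.natDegree * x.1 + x.2) (fun x => x.2) M N
      (fun x hx => (hB _ _ hx).1) (fun x hx => (hB _ _ hx).2) (by
        obtain ⟨i, j, h, -⟩ := t1; exact ⟨(i, j), h⟩)
    have hE0 : (p.natDegree : ℤ) * i0 + j0 = M := by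
      obtain ⟨i, j, h, h'⟩ := t1
      have a1 := hmax (i, j) h
      have a2 := (hB _ _ h0).1
      simp only at a1 a2
      rcases a1 with a1 | a1 <;> omega
    have hv := vertex p p0 hd f hx hy (N+1) 1 (by positivity) one_pos i0 j0 h0 (by omega) (by
      intro i j hij
      have a1 := hmax (i, j) hij
      have a2 := (hB _ _ hij).2
      simp only at a1 a2
      rcases a1 with a1 | ⟨a1, a3⟩
      · right
        have : ((N:ℤ)+1) * (p.natDegree * i + j) ≤ (N+1) * (p.natDegree * i0 + j0 - 1) :=
          mul_le_mul_of_nonneg_left (by omega) (by positivity)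
        have : (0:ℤ) ≤ j0 := by positivity
        linarith
      · rcases lt_or_eq_of_le a3 with a3 | a3
        · right; rw [a1]; linarith
        · left
          have e : j = j0 := by exact_mod_cast a3
          exact ⟨inj _ _ _ _ a1 e, e⟩)
    rcases hv with hv | hv
    · subst hv
      exact ⟨i0, h0, by simpa using hE0⟩
    · omega
  · obtain ⟨⟨i0, j0⟩, h0, hmax⟩ := lexmax S (fun x => x.2) (fun x => p.natDegree * x.1 + x.2) N M
      (fun x hx => (hB _ _ hx).2) (fun x hx => (hB _ _ hx).1) (by
        obtain ⟨i, j, h, -⟩ := t1; exact ⟨(i, j), h⟩)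
    have hE0 : j0 = N := by
      obtain ⟨i, j, h, h'⟩ := t2
      have a1 := hmax (i, j) h
      have a2 := (hB _ _ h0).2
      simp only at a1 a2
      rcases a1 with a1 | a1 <;> omega
    have he : 0 ≤ (p.natDegree : ℤ) * i0 + j0 := by
      refine lead_nonneg' p0 hf i0 j0 h0 (fun k hk => ?_)
      by_contra hne
      have := (hB _ _ hne).2
      omega
    have hv := vertex p p0 hd f hx hy 1 (M+1) one_pos (by positivity) i0 j0 h0 he (by
      intro i j hij
      have a1 := hmax (i, j) hij
      have a2 := (hB _ _ hij).1
      simp only at a1 a2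
      rcases a1 with a1 | ⟨a1, a3⟩
      · right
        have : ((M:ℤ)+1) * j ≤ (M+1) * (j0 - 1) :=
          mul_le_mul_of_nonneg_left (by omega) (by positivity)
        linarith
      · have e : j = j0 := by exact_mod_cast a1
        rcases lt_or_eq_of_le a3 with a3 | a3
        · right; rw [e] at a3 ⊢; linarith
        · left
          exact ⟨inj _ _ _ _ a3 e, e⟩)
    rcases hv with hv | hv
    · omega
    · subst hE0
      exact ⟨i0, h0, by linarith⟩
  · by_contra hcon
    push Not at hcon
    obtain ⟨i1, j1, h1, hQ1⟩ := hcon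
    obtain ⟨⟨i0, j0⟩, h0, hmax⟩ := lexmax S (fun x => (N:ℤ) * (p.natDegree * x.1 + x.2) + M * x.2)
      (fun x => p.natDegree * x.1 + x.2) (N * M + M * N) M
      (fun x hx => by
        have a := hB _ _ hx
        have b1 := mul_le_mul_of_nonneg_left a.1 (by positivity : (0:ℤ) ≤ N)
        have b2 := mul_le_mul_of_nonneg_left a.2 (by positivity : (0:ℤ) ≤ M)
        linarith) (fun x hx => (hB _ _ hx).1) ⟨(i1, j1), h1⟩
    simp only at hmax
    have hQ0 : (N:ℤ) * M < N * (p.natDegree * i0 + j0) + M * j0 := by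
      have a1 := hmax (i1, j1) h1
      simp only at a1
      rcases a1 with a1 | a1 <;> linarith [a1]
    have he : 0 ≤ (p.natDegree : ℤ) * i0 + j0 := by
      refine lead_nonneg' p0 hf i0 j0 h0 (fun k hk => ?_)
      by_contra hne
      have hk' : (j0:ℤ) + 1 ≤ k := by exact_mod_cast hk
      have a1 := hmax (i0, k) hne
      simp only at a1
      have b1 := mul_le_mul_of_nonneg_left hk' (by positivity : (0:ℤ) ≤ N)
      have b2 := mul_le_mul_of_nonneg_left hk' (by positivity : (0:ℤ) ≤ M)
      rcases a1 with a1 | a1 <;> linarith [a1]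
    have hv := vertex p p0 hd f hx hy (N * (M+1) + 1) (M * (M+1)) (by positivity)
      (mul_pos (by linarith) (by positivity)) i0 j0 h0 he (by
      intro i j hij
      have a1 := hmax (i, j) hij
      have a2 := (hB _ _ hij).1
      simp only at a1 a2
      rcases a1 with a1 | ⟨a1, a3⟩
      · right
        have b := mul_le_mul_of_nonneg_left (Int.add_one_le_of_lt a1) (by positivity : (0:ℤ) ≤ M + 1)
        linarith
      · have b := congrArg (fun t : ℤ => (M+1) * t) a1
        rcases lt_or_eq_of_le a3 with a3 | a3
        · right; linarith
        · left
          have e' : (M:ℤ) * j = M * j0 := by rw [a3] at a1; linarith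
          have e'' : (j:ℤ) = j0 := mul_left_cancel₀ (by omega) e'
          have e : j = j0 := by exact_mod_cast e''
          exact ⟨inj _ _ _ _ a3 e, e⟩)
    have a := hB _ _ h0
    simp only at a
    have b1 := mul_le_mul_of_nonneg_left a.1 (by positivity : (0:ℤ) ≤ N)
    have b2 := mul_le_mul_of_nonneg_left a.2 (by positivity : (0:ℤ) ≤ M)
    rcases hv with hv | hv
    · subst hv; simp at hQ0 b1; linarith
    · rw [hv] at hQ0; linarith

lemma mon_one_mem : mon 1 1 ∈ ASub p := by
  have h := Phi_mem (oX p); rwa [Phi_X] at h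
lemma mon_y_mem : mon (-1) p ∈ ASub p := by
  have h := Phi_mem (oY p); rwa [Phi_Y] at h

lemma reduce (p0 : p ≠ 0) (hd : 1 ≤ p.natDegree) {f : LR} (hf : f ∈ ASub p) (hL : adLN p f)
    (M N : ℕ) (hNM : N ≤ M) (hN : 1 ≤ N) (hB : HB p f M N)
    (t1 : ∃ i j, (cf i f).coeff j ≠ 0 ∧ (p.natDegree : ℤ) * i + j = M)
    (t2 : ∃ i j, (cf i f).coeff j ≠ 0 ∧ j = N) :
    ∃ c κ, 1 ≤ κ ∧ HB p (phi c κ f) (M-1) N := by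
  obtain ⟨⟨m, hm, em⟩, ⟨m2, hm2, em2⟩, hQ⟩ := edges p0 hd hf (hL _ mon_one_mem) (hL _ mon_y_mem) M N hNM hN hB t1 t2
  have hd' : (0:ℤ) < p.natDegree := by exact_mod_cast hd
  have hN' : (1:ℤ) ≤ N := by exact_mod_cast hN
  have hM' : (N:ℤ) ≤ M := by exact_mod_cast hNM
  set A : ℤ := N * p.natDegree with hAd
  set B : ℤ := N + M with hBd
  set W : ℤ := N * M with hWd
  have hA : 0 < A := mul_pos (by linarith) hd'
  have hBp : 0 < B := by omega
  have eQ : ∀ (i : ℤ) (j : ℕ), A * i + B * j = N * (p.natDegree * i + j) + M * j := by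
    intro i j; rw [hAd, hBd]; ring
  have htop : topLE W (Theta A B f) := topLE_Theta A B hA.ne' f W (fun i j h => by rw [eQ]; exact hQ i j h)
  set F := cf W (Theta A B f) with hFd
  have hF0 : F.coeff 0 ≠ 0 := by
    have h := coeff_Theta A B hA.ne' f m 0
    have e : A * m + B * (0:ℕ) = W := by rw [eQ, em]; push_cast; rw [hWd]; ring
    rw [e] at h; rw [hFd, h]; exact hm
  have hFN : F.coeff N ≠ 0 := by
    have h := coeff_Theta A B hA.ne' f m2 N
    have e : A * m2 + B * N = W := by rw [eQ, em2, hWd]; ring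
    rw [e] at h; rw [hFd, h]; exact hm2
  have hFdeg : F.natDegree = N := by
    apply le_antisymm
    · rw [natDegree_le_iff_coeff_eq_zero]
      intro j hj
      by_cases hh : ∃ i, A*i+B*j = W
      · obtain ⟨i, hi⟩ := hh
        rw [hFd, ← hi, coeff_Theta A B hA.ne']
        by_contra hne
        have := (hB _ _ hne).2
        omega
      · push Not at hh
        exact coeff_Theta_eq_zero A B f W j hh
    · exact le_natDegree_of_ne_zero hFN
  obtain ⟨c, a, ha, hFe⟩ := single_root F N hN hFdeg (by
    intro c r F1 h1 h2
    obtain ⟨n, hn⟩ := order_lemma A B hA.ne' f (mon 1 1) W A htop (by rw [Theta_x]; exact topLE_mon A 1) c r 0 F1 1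
      h1 h2 (by rw [Theta_x, cf_mon_same]; simp) (by simp) (hL _ mon_one_mem)
    push_cast at hn
    have h3 : (n:ℤ) * ((r+1) * B - W) = (r+1) * A := by linarith
    have h4 : 0 < (n:ℤ) * ((r+1) * B - W) := by rw [h3]; positivity
    have h5 : 0 < ((r:ℤ)+1) * B - W := pos_of_mul_pos_right h4 (by positivity)
    by_contra hcon
    have h6 : 2 * ((r:ℤ)+1) ≤ N := by exact_mod_cast (not_lt.1 hcon)
    have h7 : ((r:ℤ)+1) * B ≤ (r+1) * (2 * M) := mul_le_mul_of_nonneg_left (by omega) (by positivity)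
    have h8 := mul_le_mul_of_nonneg_right h6 (by positivity : (0:ℤ) ≤ M)
    linarith)
  have hc0 : c ≠ 0 := by
    rintro rfl
    apply hF0
    rw [hFe]; simp; omega
  have hc1 : F.coeff 1 ≠ 0 := by
    rw [hFe, coeff_C_mul, sub_eq_add_neg, ← C_neg, coeff_X_add_C_pow]
    refine mul_ne_zero ha (mul_ne_zero (pow_ne_zero _ (neg_ne_zero.2 hc0)) ?_)
    rw [Nat.choose_one_right]; exact_mod_cast (by omega : N ≠ 0)
  obtain ⟨i1, hi1⟩ : ∃ i, A * i + B * (1:ℕ) = W := by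
    by_contra hcon
    push Not at hcon
    exact hc1 (coeff_Theta_eq_zero A B f W 1 hcon)
  have eWm : W = A * m := by rw [hWd, hAd, ← em]; ring
  have hB1 : B = A * (m - i1) := by push_cast at hi1; linarith
  have hk : 0 < m - i1 := by
    rw [hB1] at hBp; exact pos_of_mul_pos_right hBp hA.le
  obtain ⟨κ, hκ⟩ := Int.eq_ofNat_of_zero_le hk.le
  rw [hκ] at hB1 hk
  refine ⟨c, κ, by exact_mod_cast hk, ?_⟩
  have hT : ∀ k, cf k (Theta A B (phi c κ f)) = (cf k (Theta A B f)).comp (X + C c) := by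
    intro k
    have := Theta_phi A c κ f k
    rw [← hB1] at this; exact this
  have hterm : ∀ (i : ℤ) (j : ℕ), (cf i (phi c κ f)).coeff j ≠ 0 →
      A * i + B * j ≤ W ∧ (A * i + B * j = W → j = N) := by
    intro i j h
    rw [← coeff_Theta A B hA.ne', hT] at h
    constructor
    · by_contra hcon
      rw [htop _ (not_le.1 hcon)] at h
      simp at h
    · intro e
      rw [e, ← hFd, hFe] at h
      simp [coeff_X_pow] at h
      exact h.1
  have hf' := phi_mem c κ (by exact_mod_cast hk) hf
  have hM0 : (((M-1:ℕ)):ℤ) = M - 1 := by omega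
  intro i j h
  have hne : cf i (phi c κ f) ≠ 0 := by rintro h0; rw [h0] at h; simp at h
  have l1 := lead_nonneg p0 hf' i hne
  have l2 := (hterm i _ (by rw [coeff_natDegree]; exact leadingCoeff_ne_zero.2 hne)).1
  have l3 := le_natDegree_of_ne_zero h
  obtain ⟨l4, l5⟩ := hterm i j h
  rw [eQ] at l2 l4 l5
  set n := (cf i (phi c κ f)).natDegree
  constructor
  · rw [hM0]
    have hj : (0:ℤ) ≤ M * j := by positivity
    have e1 : (p.natDegree:ℤ) * i + j ≤ M := by
      refine le_of_mul_le_mul_left ?_ (by linarith : (0:ℤ) < N)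
      linarith
    by_contra hcon
    have e2 : (p.natDegree:ℤ) * i + j = M := by omega
    rw [e2] at l4 l5
    have hj0 : (M:ℤ) * j = 0 := by linarith
    have hj1 : (j:ℤ) = 0 := by
      rcases mul_eq_zero.1 hj0 with h | h <;> omega
    have := l5 (by rw [hj0, hWd]; ring)
    omega
  · have e0 : (0:ℤ) ≤ N * (p.natDegree * i + n) := mul_nonneg (by positivity) l1
    have e1 : (n:ℤ) ≤ N := by
      refine le_of_mul_le_mul_left ?_ (by linarith : (0:ℤ) < M)
      linarith
    omega

lemma swap_HB (p0 : p ≠ 0) (a : ODan p) (M N : ℕ) (h : HB p (Phi p a) M N) :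
    HB p (Phi p (sig p a)) N M := by
  intro i j hij
  have hne : cf i (Phi p (sig p a)) ≠ 0 := by rintro h0; rw [h0] at hij; simp at hij
  have l3 : (j:ℤ) ≤ (cf i (Phi p (sig p a))).natDegree := by exact_mod_cast le_natDegree_of_ne_zero hij
  obtain ⟨k, rfl | rfl⟩ := Int.eq_nat_or_neg i
  · have e := (cf_sig a k).2
    have hne' : cf (-k) (Phi p a) ≠ 0 := by rw [← e]; exact mul_ne_zero (pow_ne_zero _ p0) hne
    have := HB_lead h _ hne'
    rw [← e, natDegree_mul (pow_ne_zero _ p0) hne, natDegree_pow] at this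
    push_cast at this
    constructor <;> linarith [this.1, this.2]
  · have e := (cf_sig a k).1
    have hne' : cf k (Phi p a) ≠ 0 := by rintro h0; rw [e, h0] at hne; simp at hne
    have := HB_lead h _ hne'
    rw [e, natDegree_mul (pow_ne_zero _ p0) hne', natDegree_pow] at l3
    push_cast at l3
    constructor <;> linarith [this.1, this.2]

lemma swap_adLN (p0 : p ≠ 0) (a : ODan p) (h : adLN p (Phi p a)) : adLN p (Phi p (sig p a)) := by
  intro g hg
  obtain ⟨b, rfl⟩ := Phi_surj hg
  obtain ⟨n, hn⟩ := h _ (Phi_mem (sig p b))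
  refine ⟨n, ?_⟩
  rw [← iterate_Ham p0] at hn ⊢
  have hn' : (Ham p0 a)^[n] (sig p b) = 0 := Phi_inj p0 (by rw [hn, map_zero])
  have := iterate_sig p0 a (sig p b) n
  rw [hn', sig_sig, map_zero, neg_zero, or_self] at this
  rw [this, map_zero]

lemma swap_Good (a : ODan p) (h : Good p (Phi p (sig p a))) : Good p (Phi p a) := by
  have := (cf_sig a 0).1
  simp at this
  obtain ⟨c, h, e⟩ := h
  exact ⟨c, h, by rw [← this, e]⟩

theorem LN_good (p0 : p ≠ 0) (hd : 1 ≤ p.natDegree) (s : ℕ) : ∀ (M N : ℕ) (f : LR), M + N = s → f ∈ ASub p →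
    adLN p f → HB p f M N → Good p f := by
  induction s using Nat.strong_induction_on with
  | _ s ih =>
  have key : ∀ (M N : ℕ) (f : LR), N ≤ M → M + N = s → f ∈ ASub p → adLN p f → HB p f M N → Good p f := by
    intro M N f hNM hs hf hL hB
    rcases Nat.eq_zero_or_pos N with h0 | h0
    · refine ⟨(cf 0 f).coeff 0, 0, ?_⟩
      rw [mul_zero, derivative_zero, add_zero]
      apply eq_C_of_natDegree_eq_zero
      rw [← Nat.le_zero, natDegree_le_iff_coeff_eq_zero]
      intro j hj
      by_contra hne
      have := (hB _ _ hne).2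
      omega
    by_cases t1 : ∃ i j, (cf i f).coeff j ≠ 0 ∧ (p.natDegree : ℤ) * i + j = M
    · by_cases t2 : ∃ i j, (cf i f).coeff j ≠ 0 ∧ j = N
      · obtain ⟨c, κ, hκ, h⟩ := reduce p0 hd hf hL M N hNM h0 hB t1 t2
        exact phi_good c κ hκ hf (ih (M - 1 + N) (by omega) (M-1) N _ rfl (phi_mem c κ hκ hf)
          (phi_adLN c κ hκ hL) h)
      · push Not at t2
        refine ih (M + (N-1)) (by omega) M (N-1) f rfl hf hL (fun i j h => ?_)
        have := hB i j h
        have := t2 i j h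
        omega
    · push Not at t1
      refine ih (M - 1 + N) (by omega) (M-1) N f rfl hf hL (fun i j h => ?_)
      have := hB i j h
      have := t1 i j h
      omega
  intro M N f hs hf hL hB
  rcases le_total N M with h | h
  · exact key M N f h hs hf hL hB
  · obtain ⟨a, rfl⟩ := Phi_surj hf
    exact swap_Good a (key N M _ h (by omega) (Phi_mem _) (swap_adLN p0 a hL) (swap_HB p0 a M N hB))

lemma exists_HB (f : LR) : ∃ M N, HB p f M N := by
  refine ⟨∑ i ∈ f.coeff.support, (p.natDegree * i.natAbs + (cf i f).natDegree),
    ∑ i ∈ f.coeff.support, (cf i f).natDegree, ?_⟩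
  intro i j h
  have hi : i ∈ f.coeff.support := by
    rw [Finsupp.mem_support_iff]
    intro h0
    apply h
    have : cf i f = 0 := h0
    rw [this]; simp
  have h1 := le_natDegree_of_ne_zero h
  have h2 := Finset.single_le_sum (f := fun i => p.natDegree * i.natAbs + (cf i f).natDegree) (fun _ _ => Nat.zero_le _) hi
  have h3 := Finset.single_le_sum (f := fun i => (cf i f).natDegree) (fun _ _ => Nat.zero_le _) hi
  constructor
  · have h4 : (p.natDegree : ℤ) * i ≤ p.natDegree * i.natAbs := mul_le_mul_of_nonneg_left (by omega) (by positivity)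
    zify at h2 h1
    push_cast at h2 ⊢
    rw [Int.natCast_natAbs] at h4
    linarith
  · exact_mod_cast h1.trans h3

theorem Ham_good (p0 : p ≠ 0) (hd : 1 ≤ p.natDegree) (a : ODan p) (h : IsLND (Ham p0 a)) : Good p (Phi p a) := by
  obtain ⟨M, N, hB⟩ := exists_HB (p := p) (Phi p a)
  refine LN_good p0 hd _ M N _ rfl (Phi_mem a) ?_ hB
  intro g hg
  obtain ⟨b, rfl⟩ := Phi_surj hg
  obtain ⟨n, hn⟩ := (LND_iff _).1 h b
  exact ⟨n, by rw [← iterate_Ham p0, hn, map_zero]⟩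

end


section
variable {p : ℂ[X]}

lemma mem_br {G : Submodule ℂ LR} {i j : ℤ} {a c : ℂ[X]} (h : br (mon i a) (mon j c) ∈ G) (k : ℤ)
    (hk : i + j = k) (r : ℂ) (b : ℂ[X])
    (e : b = C r * (C (i:ℂ) * (a * derivative c) - C (j:ℂ) * (derivative a * c))) : mon k b ∈ G := by
  rw [br_mon, hk] at h
  have h2 := G.smul_mem r h
  rw [← map_smul] at h2
  rw [e]
  simpa only [smul_eq_C_mul] using h2

variable (p) in
/-- derivatives of multiples of `p` -/
def DP : Submodule ℂ ℂ[X] := LinearMap.range ((derivative : ℂ[X] →ₗ[ℂ] ℂ[X]) ∘ₗ LinearMap.mulLeft ℂ p)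

lemma mem_DP {g : ℂ[X]} : g ∈ DP p ↔ ∃ h, g = derivative (p * h) := by
  simp only [DP, LinearMap.mem_range, LinearMap.comp_apply, LinearMap.mulLeft_apply]
  exact ⟨fun ⟨h, e⟩ => ⟨h, e.symm⟩, fun ⟨h, e⟩ => ⟨h, e.symm⟩⟩

variable (p) in
def hSub : Submodule ℂ LR := Subalgebra.toSubmodule (ASub p) ⊓ (DP p).comap (cf 0)

lemma mem_hSub {f : LR} : f ∈ hSub p ↔ f ∈ ASub p ∧ cf 0 f ∈ DP p := Iff.rfl

lemma cf_zero_br (i : ℤ) (a : ℂ[X]) (g : LR) :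
    cf 0 (br (mon i a) g) = C (i:ℂ) * derivative (a * cf (-i) g) := by
  induction g using LR_induction with
  | add f g hf hg => rw [br_add, map_add, hf, hg, map_add, mul_add, derivative_add, mul_add]
  | hm j b =>
    rw [br_mon, cf_mon, cf_mon]
    by_cases h : i + j = 0
    · have hj : j = -i := by omega
      subst hj
      rw [if_pos h, if_pos rfl, derivative_mul, smul_eq_C_mul, smul_eq_C_mul]
      push_cast
      rw [C_neg]; ring
    · rw [if_neg h, if_neg (by omega)]; simp

lemma zero_br (g : LR) : br 0 g = 0 := by simp [br]

lemma br_hSub {f g : LR} (hf : f ∈ ASub p) (hg : g ∈ ASub p) : br f g ∈ hSub p := by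
  refine mem_hSub.2 ⟨br_mem' hf hg, ?_⟩
  have key : ∀ s : Finset ℤ, cf 0 (br (∑ i ∈ s, mon i (cf i f)) g) ∈ DP p := by
    intro s
    induction s using Finset.induction_on with
    | empty => rw [Finset.sum_empty, zero_br, map_zero]; exact zero_mem _
    | insert i s hi ih =>
      rw [Finset.sum_insert hi, add_br, map_add]
      refine add_mem ?_ ih
      rw [cf_zero_br, ← smul_eq_C_mul]
      by_cases h0 : i = 0
      · subst h0; simp
      · refine Submodule.smul_mem _ _ ?_
        have hdv : p ∣ cf i f * cf (-i) g := by
          rcases lt_or_gt_of_ne h0 with h | h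
          · exact Dvd.dvd.mul_right (dvd_trans (dvd_pow_self p (by omega)) (hf i)) _
          · exact Dvd.dvd.mul_left (dvd_trans (dvd_pow_self p (by omega)) (hg (-i))) _
        obtain ⟨q, hq⟩ := hdv
        exact mem_DP.2 ⟨q, by rw [hq]⟩
  have := key f.coeff.support
  rwa [← LR_sum] at this

lemma hSub_x (i : ℕ) (hi : 1 ≤ i) (g : ℂ[X]) : mon i g ∈ hSub p := by
  refine mem_hSub.2 ⟨?_, ?_⟩
  · rw [← Phi_xg (p := p)]; exact Phi_mem _
  · rw [cf_mon, if_neg (by omega)]; exact zero_mem _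
lemma hSub_y (i : ℕ) (hi : 1 ≤ i) (g : ℂ[X]) : mon (-i) (p^i * g) ∈ hSub p := by
  refine mem_hSub.2 ⟨?_, ?_⟩
  · rw [← Phi_yg (p := p)]; exact Phi_mem _
  · rw [cf_mon, if_neg (by omega)]; exact zero_mem _
lemma hSub_z (h : ℂ[X]) : mon 0 (derivative (p * h)) ∈ hSub p := by
  refine mem_hSub.2 ⟨mon0_mem _, ?_⟩
  rw [cf_mon_same]; exact mem_DP.2 ⟨h, rfl⟩

lemma hSub_le (G : Submodule ℂ LR) (hx : ∀ i : ℕ, 1 ≤ i → ∀ g, mon i g ∈ G)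
    (hy : ∀ i : ℕ, 1 ≤ i → ∀ g, mon (-i) (p^i * g) ∈ G) (hz : ∀ h, mon 0 (derivative (p * h)) ∈ G) :
    hSub p ≤ G := by
  intro f hf
  obtain ⟨h1, h2⟩ := mem_hSub.1 hf
  rw [LR_sum f]
  refine Submodule.sum_mem _ (fun i _ => ?_)
  rcases lt_trichotomy i 0 with h | h | h
  · obtain ⟨k, hk⟩ := Int.eq_ofNat_of_zero_le (by omega : 0 ≤ -i)
    obtain ⟨q, hq⟩ := h1 i
    have e : i = -(k:ℤ) := by omega
    rw [hq, hk, Int.toNat_natCast, e]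
    exact hy k (by omega) q
  · subst h
    obtain ⟨q, hq⟩ := mem_DP.1 h2
    rw [hq]; exact hz q
  · obtain ⟨k, rfl⟩ := Int.eq_ofNat_of_zero_le h.le
    exact hx k (by omega) _

/-- Generation. -/
theorem gen_le (hd : 2 ≤ p.natDegree) (hp : IsCoprime p (derivative p)) (G : Submodule ℂ LR)
    (hbr : ∀ f ∈ G, ∀ g ∈ G, br f g ∈ G) (hx : ∀ i : ℕ, 1 ≤ i → mon i 1 ∈ G)
    (hy : ∀ i : ℕ, 1 ≤ i → mon (-i) (p^i) ∈ G) : hSub p ≤ G := by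
  have D : GenData p (fun i => G.comap (mon i)) (fun i => G.comap (mon (-i) ∘ₗ LinearMap.mulLeft ℂ (p^i)))
      (G.comap (mon 0)) := by
    constructor
    · intro i hi; exact hx i hi
    · intro i hi
      simpa using hy i hi
    · intro i hi h hh
      exact mem_br (hbr _ (hx 1 le_rfl) _ hh) _ (by push_cast; ring) 1 _ (by simp)
    · intro i hi h hh
      refine mem_br (hbr _ (hy 1 le_rfl) _ hh) _ (by push_cast; ring) (-1) _ ?_
      obtain ⟨n, rfl⟩ := Nat.exists_eq_succ_of_ne_zero (by omega : i ≠ 0)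
      simp [derivative_mul, derivative_pow]
      ring
    · intro i hi g hg h hh
      have hi' : (i:ℂ) ≠ 0 := by exact_mod_cast (by omega : i ≠ 0)
      refine mem_br (hbr _ hg _ hh) _ (by push_cast; ring) (i:ℂ)⁻¹ _ ?_
      simp only [LinearMap.mulLeft_apply]
      have e : C ((i:ℂ)⁻¹) * C (i:ℂ) = 1 := by rw [← C_mul, inv_mul_cancel₀ hi', C_1]
      generalize p^i = q
      simp only [derivative_mul, Int.cast_neg, Int.cast_natCast, C_neg]
      linear_combination (-(g * (derivative q * h + q * derivative h) + derivative g * (q * h))) * e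
    · intro k hk i hi g hg
      have hi' : (i:ℂ) ≠ 0 := by exact_mod_cast (by omega : i ≠ 0)
      refine mem_br (hbr _ hk _ hg) _ (by push_cast; ring) (-(i:ℂ)⁻¹) _ ?_
      have e : C ((i:ℂ)⁻¹) * C (i:ℂ) = 1 := by rw [← C_mul, inv_mul_cancel₀ hi', C_1]
      simp only [Int.cast_zero, Int.cast_natCast, C_neg, C_0]
      linear_combination (-(derivative k * g)) * e
    · intro k hk i hi g hg
      have hi' : (i:ℂ) ≠ 0 := by exact_mod_cast (by omega : i ≠ 0)
      refine mem_br (hbr _ hk _ hg) _ (by push_cast; ring) ((i:ℂ)⁻¹) _ ?_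
      have e : C ((i:ℂ)⁻¹) * C (i:ℂ) = 1 := by rw [← C_mul, inv_mul_cancel₀ hi', C_1]
      simp only [LinearMap.mulLeft_apply, Int.cast_zero, Int.cast_natCast, C_neg, C_0, Int.cast_neg]
      linear_combination (-(derivative k * (p^i * g))) * e
    · intro j k hj hk g hg H hH
      refine mem_br (hbr _ hg _ hH) _ (by push_cast; ring) (-1) _ ?_
      simp only [LinearMap.mulLeft_apply, Int.cast_natCast, C_neg, C_1, Int.cast_neg, map_natCast]
      ring
    · intro j k hj hk g hg H hH
      refine mem_br (hbr _ hg _ hH) _ (by push_cast; ring) 1 _ ?_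
      obtain ⟨n, rfl⟩ := Nat.exists_eq_succ_of_ne_zero (by omega : j ≠ 0)
      have e : k + n.succ = (k + n) + 1 := rfl
      simp only [LinearMap.mulLeft_apply, Int.cast_natCast, C_neg, C_1, Int.cast_neg, map_natCast, derivative_mul,
        derivative_pow, e, Nat.succ_eq_add_one, Nat.add_sub_cancel]
      push_cast
      ring
  have fx := D.full hd hp
  have fy := D.swap.full hd hp
  have hx' : ∀ i : ℕ, 1 ≤ i → ∀ g, mon i g ∈ G := by
    intro i hi g
    have : g ∈ G.comap (mon i) := by rw [fx i hi]; trivial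
    exact this
  have hy' : ∀ i : ℕ, 1 ≤ i → ∀ g, mon (-i) (p^i * g) ∈ G := by
    intro i hi g
    have : g ∈ G.comap (mon (-i) ∘ₗ LinearMap.mulLeft ℂ (p^i)) := by rw [fy i hi]; trivial
    exact this
  refine hSub_le G hx' hy' (fun h => ?_)
  refine mem_br (hbr _ (hx' 1 le_rfl 1) _ (hy' 1 le_rfl h)) _ (by norm_num) 1 _ ?_
  simp

end


section
variable {p : ℂ[X]}

lemma br_zero' (g : LR) : br g 0 = 0 := by simp [br]

lemma br_sum {ι : Type*} (f : LR) (s : Finset ι) (g : ι → LR) : br f (∑ i ∈ s, g i) = ∑ i ∈ s, br f (g i) := by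
  classical
  induction s using Finset.induction_on with
  | empty => simp [br_zero']
  | insert i s hi ih => rw [Finset.sum_insert hi, Finset.sum_insert hi, br_add, ih]

lemma cf_br_one (i k : ℤ) (f : LR) : cf k (br (mon i 1) f) = C (i:ℂ) * derivative (cf (k - i) f) := by
  have : br (mon i 1) f = (i:ℂ) • (mon i 1 * Dz f) := by
    rw [br, Eu_mon, Dz_mon]; simp
  rw [this, map_smul, cf_mon_mul, cf_Dz, one_mul, smul_eq_C_mul]

lemma cf_iter_x (n : ℕ) (k : ℤ) (f : LR) : cf k ((br (mon 1 1))^[n] f) = derivative^[n] (cf (k - n) f) := by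
  induction n generalizing k with
  | zero => simp
  | succ n ih =>
    rw [Function.iterate_succ_apply', cf_br_one, ih, Function.iterate_succ_apply']
    have e : k - 1 - n = k - ((n+1:ℕ):ℤ) := by push_cast; ring
    rw [e]; simp

lemma get_rho (p0 : p ≠ 0) (hd : 2 ≤ p.natDegree) (I : Submodule ℂ LR) (hI : ∀ f ∈ hSub p, ∀ g ∈ I, br f g ∈ I)
    (f : LR) (hf : f ∈ ASub p) (hfI : f ∈ I) (hc : ∀ c, f ≠ mon 0 (C c)) :
    ∃ ρ ∈ I, (∀ k, (cf k ρ).natDegree = 0) ∧ (∀ k, k < 0 → cf k ρ = 0) ∧ ∃ k, 1 ≤ k ∧ cf k ρ ≠ 0 := by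
  classical
  have hdz : (2:ℤ) ≤ p.natDegree := by exact_mod_cast hd
  have hex : ∃ N, ∀ k, (cf k f).natDegree ≤ N := by
    obtain ⟨M, N, hB⟩ := exists_HB (p := p) f
    refine ⟨N, fun k => ?_⟩
    by_cases h0 : cf k f = 0
    · rw [h0]; simp
    · exact_mod_cast (HB_lead hB k h0).2
  have hN := Nat.find_spec hex
  have hmin := fun m => Nat.find_min hex (m := m)
  set N := Nat.find hex
  rcases Nat.eq_zero_or_pos N with h0 | h0
  · refine ⟨f, hfI, fun k => ?_, fun k hk => ?_, ?_⟩
    · have := hN k; omega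
    · by_contra hne
      have h1 := lead_nonneg p0 hf k hne
      have := hN k
      nlinarith
    · by_contra hcon
      push Not at hcon
      apply hc ((cf 0 f).coeff 0)
      apply LR_ext
      intro i
      rw [cf_mon]
      rcases lt_trichotomy i 0 with h | h | h
      · rw [if_neg (by omega)]
        by_contra hne
        have h1 := lead_nonneg p0 hf i hne
        have := hN i
        nlinarith
      · subst h
        rw [if_pos rfl]
        have := hN 0
        exact eq_C_of_natDegree_eq_zero (by omega)
      · rw [if_neg (by omega)]
        exact hcon i (by omega)
  · obtain ⟨n, hn⟩ := Nat.exists_eq_succ_of_ne_zero h0.ne'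
    have hit : ∀ m, (br (mon 1 1))^[m] f ∈ I := by
      intro m
      induction m with
      | zero => exact hfI
      | succ m ih =>
        rw [Function.iterate_succ_apply']
        exact hI _ (hSub_x 1 le_rfl 1) _ ih
    have hcf : ∀ k, cf k (br (mon 2 1) ((br (mon 1 1))^[n] f)) = C 2 * derivative^[n+1] (cf (k - 2 - n) f) := by
      intro k
      rw [cf_br_one, cf_iter_x, Function.iterate_succ_apply']; simp
    refine ⟨br (mon 2 1) ((br (mon 1 1))^[n] f), hI _ (hSub_x 2 (by omega) 1) _ (hit n), fun k => ?_, fun k hk => ?_, ?_⟩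
    · rw [hcf, natDegree_C_mul (by norm_num)]
      have h1 := natDegree_iterate_derivative (cf (k - 2 - n) f) (n+1)
      have := hN (k-2-n)
      omega
    · rw [hcf]
      have h1 : cf (k - 2 - n) f = 0 := by
        by_contra hne
        have h1 := lead_nonneg p0 hf _ hne
        have h2 := hN (k-2-n)
        rw [hn] at h2
        zify at h2
        nlinarith
      rw [h1]; simp
    · have h1 := hmin n (by omega)
      push Not at h1
      obtain ⟨k, hk⟩ := h1
      have h2 := hN k
      have h3 : (cf k f).natDegree = n + 1 := by omega
      have hne : cf k f ≠ 0 := by rintro h; rw [h] at h3; simp at h3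
      refine ⟨k + 2 + n, ?_, ?_⟩
      · have h1 := lead_nonneg p0 hf _ hne
        rw [h3] at h1
        push_cast at h1
        by_contra hcon
        nlinarith
      · rw [hcf]
        have e : k + 2 + n - 2 - n = k := by ring
        rw [e]
        intro hz
        have hz' : derivative^[n+1] (cf k f) = 0 := by
          rcases mul_eq_zero.1 hz with h | h
          · exact absurd h (by simp)
          · exact h
        have h5 := congrArg (fun q => coeff q 0) hz'
        simp only [coeff_iterate_derivative, zero_add, coeff_zero, smul_eq_zero] at h5
        rcases h5 with h5 | h5
        · exact absurd h5 (by simp [Nat.descFactorial_self, Nat.factorial_ne_zero])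
        · rw [← h3, coeff_natDegree, leadingCoeff_eq_zero] at h5
          exact hne h5

lemma reduceS (hd : 2 ≤ p.natDegree) (I : Submodule ℂ LR) (hI : ∀ f ∈ hSub p, ∀ g ∈ I, br f g ∈ I) (n : ℕ) :
    ∀ (s : Finset ℤ), s.card = n + 1 → (∀ k ∈ s, 1 ≤ k) → ∀ (r : ℤ → ℂ) (e : ℂ[X]), (∀ k ∈ s, r k ≠ 0) → e ≠ 0 →
      (∀ h, ∑ k ∈ s, mon (k+1) (C (r k) * (e * h)) ∈ I) →
      ∃ i : ℕ, 1 ≤ i ∧ ∃ e : ℂ[X], e ≠ 0 ∧ ∀ h, mon i (e * h) ∈ I := by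
  classical
  induction n with
  | zero =>
    intro s hs h1 r e hr he hm
    obtain ⟨k, rfl⟩ := Finset.card_eq_one.1 hs
    have hk := h1 k (by simp)
    have hrk := hr k (by simp)
    obtain ⟨i, hi⟩ := Int.eq_ofNat_of_zero_le (by omega : 0 ≤ k + 1)
    refine ⟨i, by omega, C (r k) * e, mul_ne_zero (by simpa using hrk) he, fun h => ?_⟩
    have := hm h
    rw [Finset.sum_singleton, hi] at this
    rwa [mul_assoc]
  | succ n ih =>
    intro s hs h1 r e hr he hm
    obtain ⟨k0, hk0⟩ : s.Nonempty := by rw [← Finset.card_pos]; omega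
    have hp2 : derivative (derivative p) ≠ 0 := by
      intro h
      have h1 := derivative_eq_zero.1 h
      have h2 := natDegree_derivative p
      omega
    refine ih (s.erase k0) (by rw [Finset.card_erase_of_mem hk0]; omega)
      (fun k hk => h1 k (Finset.mem_of_mem_erase hk)) (fun k => ((k0:ℂ) - k) * r k) (e * derivative (derivative p)) ?_
      (mul_ne_zero he hp2) ?_
    · intro k hk
      refine mul_ne_zero (sub_ne_zero.2 ?_) (hr k (Finset.mem_of_mem_erase hk))
      have := Finset.ne_of_mem_erase hk
      exact_mod_cast this.symm
    · intro h
      have a1 := hI _ (hSub_z (p := p) 1) _ (hm h)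
      have a2 := I.smul_mem ((k0:ℂ)+1) (hm (derivative (derivative p) * h))
      have a3 := I.add_mem a1 a2
      rw [br_sum, Finset.smul_sum, ← Finset.sum_add_distrib] at a3
      have e1 : ∀ k ∈ s, br (mon 0 (derivative (p * 1))) (mon (k+1) (C (r k) * (e * h))) +
          ((k0:ℂ)+1) • mon (k+1) (C (r k) * (e * (derivative (derivative p) * h))) =
          mon (k+1) (C (((k0:ℂ) - k) * r k) * (e * derivative (derivative p) * h)) := by
        intro k _
        rw [br_mon, zero_add, ← map_smul, ← map_add, mul_one]
        congr 1
        simp only [smul_eq_C_mul, C_mul, C_add, C_sub, Int.cast_add, Int.cast_one, Int.cast_zero, C_0, C_1]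
        ring
      rw [Finset.sum_congr rfl e1, ← Finset.add_sum_erase _ _ hk0] at a3
      simpa using a3

theorem simple_le (p0 : p ≠ 0) (hd : 2 ≤ p.natDegree) (hp : IsCoprime p (derivative p)) (I : Submodule ℂ LR)
    (hI : ∀ f ∈ hSub p, ∀ g ∈ I, br f g ∈ I)
    (f : LR) (hf : f ∈ ASub p) (hfI : f ∈ I) (hc : ∀ c, f ≠ mon 0 (C c)) : hSub p ≤ I := by
  classical
  obtain ⟨ρ, hρ, hdeg, hneg, k1, hk1, hne1⟩ := get_rho p0 hd I hI f hf hfI hc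
  have hp2 : derivative (derivative p) ≠ 0 := by
    intro h
    have h1 := derivative_eq_zero.1 h
    have h2 := natDegree_derivative p
    omega
  set s := ρ.coeff.support.filter (fun k => 1 ≤ k) with hs
  have hmem : ∀ k, k ∈ s ↔ cf k ρ ≠ 0 ∧ 1 ≤ k := by
    intro k
    rw [hs, Finset.mem_filter, Finsupp.mem_support_iff]; rfl
  have hsc : 0 < s.card := Finset.card_pos.2 ⟨k1, (hmem k1).2 ⟨hne1, hk1⟩⟩
  have hρC : ∀ k, cf k ρ = C ((cf k ρ).coeff 0) := fun k => eq_C_of_natDegree_eq_zero (hdeg k)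
  obtain ⟨i, hi, e, he, hie⟩ := reduceS hd I hI (s.card - 1) s (by omega) (fun k hk => ((hmem k).1 hk).2)
    (fun k => -((k:ℂ) * (cf k ρ).coeff 0)) 1 (by
      intro k hk
      have := (hmem k).1 hk
      refine neg_ne_zero.2 (mul_ne_zero (by exact_mod_cast (by omega : k ≠ 0)) ?_)
      intro h0
      apply this.1
      rw [hρC k, h0, C_0]) one_ne_zero (by
      intro h
      obtain ⟨g, rfl⟩ := exists_antideriv h
      have a1 := hI _ (hSub_x (p := p) 1 le_rfl g) _ hρ
      rw [LR_sum ρ, br_sum] at a1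
      convert a1 using 1
      rw [hs, Finset.sum_filter]
      refine Finset.sum_congr rfl (fun k _ => ?_)
      rw [br_mon]
      have hd0 : derivative (cf k ρ) = 0 := by rw [hρC k, derivative_C]
      rw [hd0, mul_zero, smul_zero, zero_sub]
      split_ifs with h1
      · have e1 : ((1:ℕ):ℤ) + k = k + 1 := by push_cast; ring
        rw [e1]
        congr 1
        conv_rhs => rw [hρC k]
        rw [smul_eq_C_mul, C_neg, C_mul]; ring
      · rcases lt_or_eq_of_le (by omega : k ≤ 0) with h2 | h2
        · rw [hneg k h2]; simp
        · rw [h2]; simp)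
  have fx := simple_poly p hp (fun i => I.comap (mon i)) (by
      intro i hi g H hH
      refine mem_br (hI _ (hSub_x 1 le_rfl g) _ hH) _ (by push_cast; ring) 1 _ ?_
      simp) (by
      intro i hi g H hH
      refine mem_br (hI _ (hSub_y 1 le_rfl g) _ hH) _ (by push_cast; ring) (-1) _ ?_
      simp only [pow_one, Int.cast_neg, Int.cast_natCast, map_natCast, C_neg]
      push_cast; simp; ring) i hi e he hie
  have hx' : ∀ i : ℕ, 1 ≤ i → ∀ g, mon i g ∈ I := by
    intro i hi g
    have : g ∈ I.comap (mon i) := by rw [fx i hi]; trivial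
    exact this
  have hz' : ∀ h, mon 0 (derivative (p * h)) ∈ I := by
    intro h
    refine mem_br (hI _ (hSub_y 1 le_rfl h) _ (hx' 1 le_rfl 1)) _ (by norm_num) (-1) _ ?_
    simp
  have fy := simple_poly p hp (fun i => I.comap (mon (-i) ∘ₗ LinearMap.mulLeft ℂ (p^i))) (by
      intro i hi g H hH
      refine mem_br (hI _ (hSub_y 1 le_rfl g) _ hH) _ (by push_cast; ring) (-1) _ ?_
      obtain ⟨n, rfl⟩ := Nat.exists_eq_succ_of_ne_zero (by omega : i ≠ 0)
      simp [derivative_mul, derivative_pow]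
      ring) (by
      intro i hi g H hH
      refine mem_br (hI _ (hSub_x 1 le_rfl g) _ hH) _ (by push_cast; ring) 1 _ ?_
      simp [derivative_mul, derivative_pow]
      ring) 1 le_rfl _ hp2 (by
      intro h
      refine mem_br (hI _ (hSub_y 1 le_rfl h) _ (hz' 1)) _ (by norm_num) (-1) _ ?_
      simp; ring)
  have hy' : ∀ i : ℕ, 1 ≤ i → ∀ g, mon (-i) (p^i * g) ∈ I := by
    intro i hi g
    have : g ∈ I.comap (mon (-i) ∘ₗ LinearMap.mulLeft ℂ (p^i)) := by rw [fy i hi]; trivial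
    exact this
  exact hSub_le I hx' hy' hz'

end


section
variable {p : ℂ[X]}

lemma LND_x (p0 : p ≠ 0) (i : ℕ) : IsLND (Ham p0 (xg p i 1)) := by
  rw [LND_iff]
  intro b
  have hit : ∀ (n : ℕ) (k : ℤ), cf k ((br (mon i 1))^[n] (Phi p b)) =
      C ((i:ℂ)^n) * derivative^[n] (cf (k - n * i) (Phi p b)) := by
    intro n
    induction n with
    | zero => intro k; simp
    | succ n ih =>
      intro k
      rw [Function.iterate_succ_apply', cf_br_one, ih, Function.iterate_succ_apply', derivative_C_mul, pow_succ, C_mul]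
      have e : k - i - n * i = k - ((n+1:ℕ):ℤ) * i := by push_cast; ring
      rw [e, Int.cast_natCast]; ring
  obtain ⟨M, N, hB⟩ := exists_HB (p := p) (Phi p b)
  refine ⟨N + 1, Phi_inj p0 ?_⟩
  rw [iterate_Ham, map_zero, Phi_xg]
  apply LR_ext
  intro k
  rw [hit, map_zero]
  have : derivative^[N+1] (cf (k - (N+1:ℕ) * i) (Phi p b)) = 0 := by
    by_cases h0 : cf (k - (N+1:ℕ) * i) (Phi p b) = 0
    · rw [h0]; simp
    · apply iterate_derivative_eq_zero
      have := (HB_lead hB _ h0).2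
      omega
  rw [this, mul_zero]

/-- Hamiltonian derivations with hamiltonian in `hSub`. -/
def hamAlg (p0 : p ≠ 0) : LieSubalgebra ℂ (Derivation ℂ (ODan p) (ODan p)) where
  toSubmodule := ((hSub p).comap (Phi p).toLinearMap).map (HamL p0)
  lie_mem' := by
    rintro _ _ ⟨a, ha, rfl⟩ ⟨b, hb, rfl⟩
    refine ⟨Ham p0 a b, ?_, (Ham_lie p0 a b).symm⟩
    change Phi p (Ham p0 a b) ∈ hSub p
    rw [Phi_Ham]
    exact br_hSub (Phi_mem a) (Phi_mem b)

lemma mem_hamAlg (p0 : p ≠ 0) {δ : Derivation ℂ (ODan p) (ODan p)} :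
    δ ∈ hamAlg p0 ↔ ∃ a, Phi p a ∈ hSub p ∧ Ham p0 a = δ := Iff.rfl

lemma lndSpan_le (p0 : p ≠ 0) (hd : 2 ≤ p.natDegree) (hp : IsCoprime p (derivative p)) :
    lndSpan p ≤ hamAlg p0 := by
  rw [lndSpan, LieSubalgebra.lieSpan_le]
  intro δ hδ
  obtain ⟨a, rfl⟩ := LND_is_Ham p0 hd hp δ hδ
  obtain ⟨c, h, e⟩ := Ham_good p0 (by omega) a hδ
  refine (mem_hamAlg p0).2 ⟨a - algebraMap ℂ _ c, mem_hSub.2 ⟨Phi_mem _, ?_⟩, ?_⟩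
  · have e2 : algebraMap ℂ LR c = mon 0 (C c) := by
      rw [mon_C, ← one_eq_mon, Algebra.algebraMap_eq_smul_one]
    rw [map_sub, AlgHom.commutes, map_sub, e, e2, cf_mon_same]
    exact mem_DP.2 ⟨h, by ring⟩
  · ext b
    apply Phi_inj p0
    rw [Phi_Ham, Phi_Ham, map_sub, AlgHom.commutes]
    have e3 := add_br (Phi p a - algebraMap ℂ LR c) (algebraMap ℂ LR c) (Phi p b)
    rw [sub_add_cancel, C_br, add_zero] at e3
    exact e3.symm

lemma hSub_lnd (p0 : p ≠ 0) (hd : 2 ≤ p.natDegree) (hp : IsCoprime p (derivative p)) (a : ODan p)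
    (ha : Phi p a ∈ hSub p) : Ham p0 a ∈ lndSpan p := by
  let G : Submodule ℂ LR := ((lndSpan p).toSubmodule.comap (HamL p0)).map (Phi p).toLinearMap
  have hG : ∀ b : ODan p, Ham p0 b ∈ lndSpan p → Phi p b ∈ G := fun b hb => ⟨b, hb, rfl⟩
  have key : hSub p ≤ G := by
    apply gen_le hd hp
    · rintro _ ⟨b, hb, rfl⟩ _ ⟨c, hc, rfl⟩
      have h1 : Ham p0 (Ham p0 b c) ∈ lndSpan p := by
        rw [← Ham_lie]; exact (lndSpan p).lie_mem hb hc
      have := hG _ h1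
      rw [Phi_Ham] at this
      exact this
    · intro i hi
      have := hG (xg p i 1) (LieSubalgebra.subset_lieSpan (LND_x p0 i))
      rwa [Phi_xg] at this
    · intro i hi
      have h1 := LND_sig p0 _ (LND_x p0 i)
      rw [sig_xg] at h1
      have := hG (yg p i 1) (LieSubalgebra.subset_lieSpan h1)
      rwa [Phi_yg, mul_one] at this
  obtain ⟨b, hb, e⟩ := key ha
  have : b = a := Phi_inj p0 e
  rw [← this]; exact hb

end

section final
variable {p : ℂ[X]}

/-- The ideal, seen inside `LR`. -/
def idl (p0 : p ≠ 0) (I : LieIdeal ℂ (lndSpan p)) : Submodule ℂ LR where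
  carrier := {f | ∃ a : ODan p, ∃ h : Ham p0 a ∈ lndSpan p, Phi p a = f ∧ (⟨Ham p0 a, h⟩ : lndSpan p) ∈ I}
  zero_mem' := by
    have e : Ham p0 (0 : ODan p) = 0 := (HamL p0).map_zero
    refine ⟨0, by rw [e]; exact zero_mem _, map_zero _, ?_⟩
    convert zero_mem I
    exact e
  add_mem' := by
    rintro _ _ ⟨a, ha, rfl, ha'⟩ ⟨b, hb, rfl, hb'⟩
    have e := Ham_add p0 a b
    refine ⟨a + b, by rw [e]; exact add_mem ha hb, map_add _ _ _, ?_⟩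
    convert add_mem ha' hb'
    exact e
  smul_mem' := by
    rintro c _ ⟨a, ha, rfl, ha'⟩
    have e := Ham_smul p0 c a
    refine ⟨c • a, by rw [e]; exact (lndSpan p).smul_mem c ha, map_smul _ _ _, ?_⟩
    have h1 : (⟨Ham p0 (c • a), by rw [e]; exact (lndSpan p).smul_mem c ha⟩ : lndSpan p) = c • ⟨Ham p0 a, ha⟩ :=
      Subtype.ext e
    rw [h1]
    exact I.smul_mem c ha'

theorem main_aux (hdeg : 2 ≤ p.natDegree) (hsq : Squarefree p) :
    lndSpan p ≠ ⊥ ∧ ∀ I : LieIdeal ℂ (lndSpan p), I = ⊥ ∨ I = ⊤ := by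
  have p0 : p ≠ 0 := by rintro rfl; simp at hdeg
  have hp : IsCoprime p (derivative p) := PerfectField.separable_iff_squarefree.2 hsq
  constructor
  · intro h
    have h1 : Ham p0 (xg p 1 1) ∈ lndSpan p := LieSubalgebra.subset_lieSpan (LND_x p0 1)
    rw [h, LieSubalgebra.mem_bot] at h1
    have h2 := Phi_Ham p0 (xg p 1 1) (oZ p)
    rw [h1, Derivation.zero_apply, map_zero, Phi_xg, Phi_Z, br_mon] at h2
    have h3 := congrArg (cf 1) h2
    rw [map_zero, cf_mon] at h3
    simp at h3
  · intro I
    by_cases hI : I = ⊥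
    · left; exact hI
    right
    obtain ⟨δ, hδI, hδ0⟩ : ∃ δ ∈ I, δ ≠ 0 := by
      by_contra hcon
      push Not at hcon
      exact hI ((LieSubmodule.eq_bot_iff I).2 hcon)
    obtain ⟨δ, hδ⟩ := δ
    obtain ⟨a, ha, rfl⟩ := (mem_hamAlg p0).1 (lndSpan_le p0 hdeg hp hδ)
    have key : hSub p ≤ idl p0 I := by
      refine simple_le p0 hdeg hp _ ?_ (Phi p a) (Phi_mem a) ⟨a, hδ, rfl, hδI⟩ ?_
      · rintro f hf _ ⟨b, hb, rfl, hbI⟩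
        obtain ⟨c, rfl⟩ := Phi_surj (mem_hSub.1 hf).1
        have hc := hSub_lnd p0 hdeg hp c hf
        have e := Ham_lie p0 c b
        refine ⟨Ham p0 c b, by rw [← e]; exact (lndSpan p).lie_mem hc hb, Phi_Ham p0 c b, ?_⟩
        have := lie_mem_right ℂ (lndSpan p) I ⟨Ham p0 c, hc⟩ ⟨Ham p0 b, hb⟩ hbI
        convert this
        exact e.symm
      · intro c hc
        apply hδ0
        have e2 : algebraMap ℂ LR c = mon 0 (C c) := by
          rw [mon_C, ← one_eq_mon, Algebra.algebraMap_eq_smul_one]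
        have e3 : a = algebraMap ℂ _ c := Phi_inj p0 (by rw [AlgHom.commutes, e2, hc])
        apply Subtype.ext
        change Ham p0 a = 0
        rw [e3, Ham_C]
    rw [eq_top_iff]
    rintro ⟨δ, hδ'⟩ -
    obtain ⟨b, hb, rfl⟩ := (mem_hamAlg p0).1 (lndSpan_le p0 hdeg hp hδ')
    obtain ⟨b', h1, h2, h3⟩ := key hb
    have : b' = b := Phi_inj p0 h2
    subst this
    exact h3

end final

/-- If `p` has degree at least `2` and no multiple roots, then the Lie algebra
`⟨LND(D_p)⟩` is simple: it is nonzero and its only Lie ideals are `0` and itself. -/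
theorem lndSpan_simple (p : ℂ[X]) (hdeg : 2 ≤ p.natDegree) (hsq : Squarefree p) :
    lndSpan p ≠ ⊥ ∧ ∀ I : LieIdeal ℂ (lndSpan p), I = ⊥ ∨ I = ⊤ := by
  exact main_aux hdeg hsq

end
end

section
/- Let R := ℂ[x,y]^{μ₂} be the ℂ-subalgebra of ℂ[x,y] generated by x², xy, y² (the coordinate ring of 𝔸²/μ₂), and let m be the ideal of R generated by x², xy, y² (the maximal ideal of the singular point). Then every locally nilpotent ℂ-derivation δ of R satisfies δ(R) ⊆ m; consequently every element of the Lie subalgebra of Der_ℂ(R) generated by the locally nilpotent derivations maps R into m. -/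
set_option synthInstance.maxHeartbeats 1000000
set_option maxHeartbeats 1600000

noncomputable section

/-- The polynomial ring `ℂ[x,y]` (variables indexed by `Fin 2`). -/
abbrev P2 : Type := MvPolynomial (Fin 2) ℂ

/-- The invariant ring `R = ℂ[x,y]^{μ₂} = ℂ[x², xy, y²]`, i.e. the subalgebra of
`ℂ[x,y]` generated by `x²`, `xy`, `y²`. -/
def Rinv : Subalgebra ℂ P2 :=
  Algebra.adjoin ℂ {MvPolynomial.X 0 * MvPolynomial.X 0,
    MvPolynomial.X 0 * MvPolynomial.X 1, MvPolynomial.X 1 * MvPolynomial.X 1}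

/-- `x²` as an element of `R`. -/
def x2 : Rinv := ⟨MvPolynomial.X 0 * MvPolynomial.X 0, Algebra.subset_adjoin (by simp)⟩
/-- `xy` as an element of `R`. -/
def xy2 : Rinv := ⟨MvPolynomial.X 0 * MvPolynomial.X 1, Algebra.subset_adjoin (by simp)⟩
/-- `y²` as an element of `R`. -/
def y2 : Rinv := ⟨MvPolynomial.X 1 * MvPolynomial.X 1, Algebra.subset_adjoin (by simp)⟩

/-- The maximal ideal `m = (x², xy, y²)` of the singular point of `𝔸²/μ₂`. -/
def mIdeal : Ideal Rinv := Ideal.span {x2, xy2, y2}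

/-- A derivation is locally nilpotent if some power of it kills each element. -/
def IsLNDR (δ : Derivation ℂ Rinv Rinv) : Prop :=
  ∀ f : Rinv, ∃ n : ℕ, 1 ≤ n ∧ (δ.toLinearMap ^ n) f = 0

open MvPolynomial in
/-- The three constant terms vanish because of the relation `x² y² = (xy)²`. -/
lemma const_terms (p q r : P2)
    (h : X 0 * X 0 * q + X 1 * X 1 * p = 2 * (X 0 * X 1 * r)) :
    constantCoeff p = 0 ∧ constantCoeff q = 0 ∧ constantCoeff r = 0 := by
  have h2 : (constantCoeff (2 : P2) : ℂ) ≠ 0 := by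
    rw [map_ofNat]
    norm_num
  refine ⟨?_, ?_, ?_⟩
  · have := congrArg (fun f => constantCoeff (pderiv 1 (pderiv 1 f))) h
    simpa [pderiv_X, Pi.single_apply, two_mul, ← two_mul, h2] using this
  · have := congrArg (fun f => constantCoeff (pderiv 0 (pderiv 0 f))) h
    simpa [pderiv_X, Pi.single_apply, two_mul, ← two_mul, h2] using this
  · have := congrArg (fun f => constantCoeff (pderiv 0 (pderiv 1 f))) h
    simpa [pderiv_X, Pi.single_apply, two_mul, ← two_mul, h2] using this

/-- Induction principle for `R`. -/
lemma Rinv_induction (Q : Rinv → Prop) (h1 : Q x2) (h2 : Q xy2) (h3 : Q y2)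
    (hc : ∀ c : ℂ, Q (algebraMap ℂ Rinv c))
    (ha : ∀ f g, Q f → Q g → Q (f + g)) (hm : ∀ f g, Q f → Q g → Q (f * g))
    (f : Rinv) : Q f := by
  obtain ⟨f, hf⟩ := f
  refine Algebra.adjoin_induction (p := fun f hf => Q ⟨f, hf⟩) ?_ ?_ ?_ ?_ hf
  · rintro x (rfl | rfl | rfl)
    exacts [h1, h2, h3]
  · exact hc
  · intro x y hx hy a b
    exact ha _ _ a b
  · intro x y hx hy a b
    exact hm _ _ a b

/-- The augmentation `R → ℂ`. -/
def aug : Rinv →ₐ[ℂ] ℂ := (MvPolynomial.aeval (fun _ : Fin 2 => (0 : ℂ))).comp Rinv.val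

lemma sub_aug_mem (f : Rinv) : f - algebraMap ℂ Rinv (aug f) ∈ mIdeal := by
  have hs : ∀ g : Rinv, g ∈ ({x2, xy2, y2} : Set Rinv) → aug g = 0 →
      g - algebraMap ℂ Rinv (aug g) ∈ mIdeal := by
    intro g hg h0
    rw [h0, map_zero, sub_zero]
    exact Ideal.subset_span hg
  refine Rinv_induction (fun f => f - algebraMap ℂ Rinv (aug f) ∈ mIdeal) ?_ ?_ ?_ ?_ ?_ ?_ f
  · exact hs _ (by simp) (by simp [aug, x2])
  · exact hs _ (by simp) (by simp [aug, xy2])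
  · exact hs _ (by simp) (by simp [aug, y2])
  · intro c
    rw [AlgHom.commutes]
    simp
  · intro f g hf hg
    have := mIdeal.add_mem hf hg
    rw [map_add, map_add]
    convert this using 1
    ring
  · intro f g hf hg
    have := mIdeal.add_mem (mIdeal.mul_mem_left f hg)
      (mIdeal.mul_mem_left (algebraMap ℂ Rinv (aug g)) hf)
    rw [map_mul, map_mul]
    convert this using 1
    ring

lemma mem_of_const (f : Rinv) (h : MvPolynomial.constantCoeff (f : P2) = 0) : f ∈ mIdeal := by
  have h1 := sub_aug_mem f
  have h0 : aug f = 0 := by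
    rw [← h]
    simp [aug]
  rwa [h0, map_zero, sub_zero] at h1

/-- In fact every derivation of `R` maps `R` into `m`. -/
lemma der_mem (δ : Derivation ℂ Rinv Rinv) (f : Rinv) : δ f ∈ mIdeal := by
  have hrel : x2 * y2 = xy2 * xy2 := by
    apply Subtype.ext
    simp only [x2, y2, xy2, MulMemClass.coe_mul]
    ring
  have hd := congrArg (fun g => ((δ g : Rinv) : P2)) hrel
  simp only [Derivation.leibniz, smul_eq_mul, Subalgebra.coe_add, Subalgebra.coe_mul] at hd
  obtain ⟨h1, h3, h2⟩ := const_terms (δ x2) (δ y2) (δ xy2) (by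
    rw [two_mul]; exact hd)
  refine Rinv_induction (fun f => δ f ∈ mIdeal) (mem_of_const _ h1) (mem_of_const _ h2)
    (mem_of_const _ h3) ?_ ?_ ?_ f
  · intro c
    simp
  · intro f g hf hg
    rw [map_add]
    exact mIdeal.add_mem hf hg
  · intro f g hf hg
    rw [Derivation.leibniz]
    exact mIdeal.add_mem (mIdeal.mul_mem_left _ hg) (mIdeal.mul_mem_left _ hf)

/-- Every locally nilpotent derivation of `R = ℂ[x,y]^{μ₂}` maps `R` into the maximal
ideal `m` of the singular point; consequently every element of the Lie subalgebra of
`Der_ℂ(R)` generated by the locally nilpotent derivations maps `R` into `m`. -/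
theorem lnd_maps_into_m :
    (∀ δ : Derivation ℂ Rinv Rinv, IsLNDR δ → ∀ f : Rinv, δ f ∈ mIdeal) ∧
    (∀ δ : Derivation ℂ Rinv Rinv,
      δ ∈ LieSubalgebra.lieSpan ℂ (Derivation ℂ Rinv Rinv) {δ' | IsLNDR δ'} →
      ∀ f : Rinv, δ f ∈ mIdeal) := by
  exact ⟨fun δ _ f => der_mem δ f, fun δ _ f => der_mem δ f⟩

end
end
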